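/- arXiv:1812.04425 — 2 statements merged into one kernel-verified Lean document; each statement's English description precedes it below -/
import Mathlib

section
/- Let Ã, R, λ, τ, n₄, n₆, σ₁, σ₃ be as given, and let S = {x ∈ R : τ(x) = x} be the fixed subring of τ. Then S is a free Ã-module of rank 8 (with Ã acting through λ), with basis 1, σ₁², σ₁⁴, n₄, σ₁²n₄, n₆, σ₁²n₆, σ₃². -/
open MvPolynomial

instance : (Ideal.span {(3 : ℤ)}).IsPrime :=
  (Ideal.span_singleton_prime (by norm_num)).mpr Int.prime_three

/-- The ring `ℤ_(3)`, the localization of `ℤ` at the prime ideal `(3)`. -/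
def Z3loc : Type := Localization.AtPrime (Ideal.span {(3 : ℤ)})

noncomputable instance : CommRing Z3loc :=
  inferInstanceAs (CommRing (Localization.AtPrime (Ideal.span {(3 : ℤ)})))

/-- The polynomial ring `Ã = ℤ_(3)[ā₂,ā₄,ā₆]`. -/
noncomputable abbrev Atilde : Type := MvPolynomial (Fin 3) Z3loc

/-- The ring `R = ℤ_(3)[z₁,z₂,z₃,r]/(z₁z₂+z₂z₃+z₃z₁)`; the variables `X 0, X 1, X 2, X 3`
are `z₁, z₂, z₃, r` respectively. -/
noncomputable abbrev Rring : Type :=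
  MvPolynomial (Fin 4) Z3loc ⧸
    (Ideal.span {(X 0 * X 1 + X 1 * X 2 + X 2 * X 0 : MvPolynomial (Fin 4) Z3loc)})

/-- The images of the variables `z₁, z₂, z₃, r` in `R`. -/
noncomputable def zR (i : Fin 4) : Rring := Ideal.Quotient.mk _ (X i)

/-- `σ₁ = z₁+z₂+z₃` in `R`. -/
noncomputable def σ₁R : Rring := zR 0 + zR 1 + zR 2

/-- `σ₃ = z₁z₂z₃` in `R`. -/
noncomputable def σ₃R : Rring := zR 0 * zR 1 * zR 2

/-- `λ(ā₂) = (1/4)(z₁−z₂+z₃)² − z₂z₃ − 3r`  (note `4` is a unit in `ℤ_(3)`). -/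
noncomputable def la2 : Rring :=
  Ring.inverse (4 : Rring) * (zR 0 - zR 1 + zR 2) ^ 2 - zR 1 * zR 2 - 3 * zR 3

/-- `λ(ā₄) = (1/2)z₁z₃²(z₁−z₂+z₃) − 2r·λ(ā₂) − 3r²`. -/
noncomputable def la4 : Rring :=
  Ring.inverse (2 : Rring) * (zR 0 * zR 2 ^ 2 * (zR 0 - zR 1 + zR 2))
    - 2 * zR 3 * la2 - 3 * zR 3 ^ 2

/-- `λ(ā₆) = (1/4)z₁²z₃⁴ − r·λ(ā₄) − r²·λ(ā₂) − r³`. -/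
noncomputable def la6 : Rring :=
  Ring.inverse (4 : Rring) * (zR 0 ^ 2 * zR 2 ^ 4)
    - zR 3 * la4 - zR 3 ^ 2 * la2 - zR 3 ^ 3

/-- The `ℤ_(3)`-algebra map `λ : Ã → R`, `ā₂ ↦ λ(ā₂)`, `ā₄ ↦ λ(ā₄)`, `ā₆ ↦ λ(ā₆)`. -/
noncomputable def lam : Atilde →ₐ[Z3loc] Rring :=
  MvPolynomial.aeval ![la2, la4, la6]

/-- `n₄ = σ₁²r − z₁³z₃ − z₁z₂³ − z₁²z₃²`. -/
noncomputable def n4R : Rring :=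
  σ₁R ^ 2 * zR 3 - zR 0 ^ 3 * zR 2 - zR 0 * zR 1 ^ 3 - zR 0 ^ 2 * zR 2 ^ 2

/-- `n₆ = σ₁²r² − 2z₁³z₃r − 2z₁z₂³r − 2z₁²z₃²r + 2z₁³z₃³ − z₁²z₃⁴`. -/
noncomputable def n6R : Rring :=
  σ₁R ^ 2 * zR 3 ^ 2 - 2 * zR 0 ^ 3 * zR 2 * zR 3 - 2 * zR 0 * zR 1 ^ 3 * zR 3
    - 2 * zR 0 ^ 2 * zR 2 ^ 2 * zR 3 + 2 * zR 0 ^ 3 * zR 2 ^ 3 - zR 0 ^ 2 * zR 2 ^ 4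

/-- The `8`-element family `1, σ₁², σ₁⁴, n₄, σ₁²n₄, n₆, σ₁²n₆, σ₃²`. -/
noncomputable def basis8 : Fin 8 → Rring :=
  ![1, σ₁R ^ 2, σ₁R ^ 4, n4R, σ₁R ^ 2 * n4R, n6R, σ₁R ^ 2 * n6R, σ₃R ^ 2]


/-! ### Basic facts on `ℤ_(3)` -/

noncomputable def z3equiv : Z3loc ≃+* Localization.AtPrime (Ideal.span {(3 : ℤ)}) :=
  RingEquiv.refl _

instance Z3loc_isDomain : IsDomain Z3loc :=
  z3equiv.toMulEquiv.isDomain _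

instance Z3loc_isNoetherian : IsNoetherianRing Z3loc :=
  isNoetherianRing_of_ringEquiv _ z3equiv.symm

theorem mem_primeCompl_three {m : ℤ} :
    m ∈ (Ideal.span {(3 : ℤ)}).primeCompl ↔ ¬ (3 : ℤ) ∣ m := by
  rw [Ideal.mem_primeCompl_iff, Ideal.mem_span_singleton]

theorem Z3loc_isUnit {m : ℕ} (hm : ¬ 3 ∣ m) : IsUnit (m : Z3loc) := by
  have h : IsUnit (algebraMap ℤ (Localization.AtPrime (Ideal.span {(3 : ℤ)})) (m : ℤ)) := by
    rw [IsLocalization.AtPrime.isUnit_to_map_iff _ (Ideal.span {(3 : ℤ)}), mem_primeCompl_three]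
    exact_mod_cast hm
  have h2 := h.map z3equiv.symm
  simpa using h2

theorem redAux_isUnit (y : (Ideal.span {(3 : ℤ)}).primeCompl) :
    IsUnit (Int.castRingHom (ZMod 3) y) := by
  have := mem_primeCompl_three.1 y.2
  rw [isUnit_iff_ne_zero]
  intro h
  apply this
  exact (ZMod.intCast_zmod_eq_zero_iff_dvd _ 3).1 h

noncomputable def red : Z3loc →+* ZMod 3 :=
  (IsLocalization.lift (M := (Ideal.span {(3 : ℤ)}).primeCompl) redAux_isUnit).comp
    (z3equiv : Z3loc →+* Localization.AtPrime (Ideal.span {(3 : ℤ)}))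

theorem red_eq_zero {x : Z3loc} (h : red x = 0) : (3 : Z3loc) ∣ x := by
  obtain ⟨⟨a, s⟩, hx⟩ := IsLocalization.surj (Ideal.span {(3 : ℤ)}).primeCompl (z3equiv x)
  have hu := redAux_isUnit s
  have h' : (IsLocalization.lift (M := (Ideal.span {(3 : ℤ)}).primeCompl)
    redAux_isUnit) (z3equiv x) = 0 := h
  have h3 := congrArg (IsLocalization.lift (M := (Ideal.span {(3 : ℤ)}).primeCompl)
    redAux_isUnit) hx
  rw [map_mul, h', zero_mul, IsLocalization.lift_eq] at h3
  have h4 : (3 : ℤ) ∣ a := (ZMod.intCast_zmod_eq_zero_iff_dvd _ 3).1 h3.symm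
  obtain ⟨b, hb⟩ := h4
  have hs := IsLocalization.map_units (Localization.AtPrime (Ideal.span {(3 : ℤ)})) s
  have h5 : (3 : Localization.AtPrime (Ideal.span {(3 : ℤ)})) ∣ z3equiv x := by
    rw [← hs.dvd_mul_right, hx]
    simp [hb]
  have h6 := map_dvd z3equiv.symm h5
  rw [map_ofNat, RingEquiv.symm_apply_apply] at h6
  exact h6

theorem three_dvd_of_map_red {σ : Type*} {f : MvPolynomial σ Z3loc}
    (h : MvPolynomial.map red f = 0) : (3 : MvPolynomial σ Z3loc) ∣ f := by
  have : (3 : MvPolynomial σ Z3loc) = C 3 := (map_ofNat C 3).symm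
  rw [this, C_dvd_iff_dvd_coeff]
  intro i
  apply red_eq_zero
  rw [← coeff_map, h, coeff_zero]

theorem red_three : red 3 = 0 := by
  rw [map_ofNat]; rfl

instance Z3loc_charZero : CharZero Z3loc := by
  have : CharZero (Localization.AtPrime (Ideal.span {(3 : ℤ)})) := by
    have hinj : Function.Injective
      (algebraMap ℤ (Localization.AtPrime (Ideal.span {(3 : ℤ)}))) :=
        IsLocalization.injective _ (Ideal.span {(3 : ℤ)}).primeCompl_le_nonZeroDivisors
    exact charZero_of_injective_algebraMap hinj
  exact charZero_of_injective_ringHom (f := (z3equiv.symm :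
    Localization.AtPrime (Ideal.span {(3 : ℤ)}) →+* Z3loc)) z3equiv.symm.injective

/-! ### Basic facts on `R` -/

theorem e2_rel : zR 0 * zR 1 + zR 1 * zR 2 + zR 2 * zR 0 = 0 := by
  have : (Ideal.Quotient.mk (Ideal.span {(X 0 * X 1 + X 1 * X 2 + X 2 * X 0 :
    MvPolynomial (Fin 4) Z3loc)})) (X 0 * X 1 + X 1 * X 2 + X 2 * X 0) = 0 :=
      Ideal.Quotient.eq_zero_iff_mem.2 (Ideal.mem_span_singleton_self _)
  rw [map_add, map_add, map_mul, map_mul, map_mul] at this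
  exact this

theorem e2_red_ne : (X 0 * X 1 + X 1 * X 2 + X 2 * X 0 : MvPolynomial (Fin 4) (ZMod 3)) ≠ 0 := by
  intro h
  have h2 := congrArg (MvPolynomial.eval ![(1 : ZMod 3), 1, 0, 0]) h
  simp at h2

theorem three_torsion {x : Rring} (h : 3 * x = 0) : x = 0 := by
  obtain ⟨f, rfl⟩ := Ideal.Quotient.mk_surjective x
  have h1 : (Ideal.Quotient.mk (Ideal.span {(X 0 * X 1 + X 1 * X 2 + X 2 * X 0 :
    MvPolynomial (Fin 4) Z3loc)})) (3 * f) = 0 := by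
      rw [map_mul, map_ofNat]; exact h
  rw [Ideal.Quotient.eq_zero_iff_mem, Ideal.mem_span_singleton] at h1
  obtain ⟨g, hg⟩ := h1
  have h2 := congrArg (MvPolynomial.map red) hg
  simp only [map_mul, map_add, MvPolynomial.map_X, map_ofNat] at h2
  have h3 : (3 : MvPolynomial (Fin 4) (ZMod 3)) = 0 := by
    have : (3 : MvPolynomial (Fin 4) (ZMod 3)) = C 3 := (map_ofNat C 3).symm
    rw [this, show (3 : ZMod 3) = 0 from rfl, C_0]
  rw [h3, zero_mul] at h2
  have h4 := (mul_eq_zero.1 h2.symm).resolve_left e2_red_ne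
  obtain ⟨g', rfl⟩ := three_dvd_of_map_red h4
  have h5 : f = (X 0 * X 1 + X 1 * X 2 + X 2 * X 0) * g' := by
    apply mul_left_cancel₀ (show (3 : MvPolynomial (Fin 4) Z3loc) ≠ 0 by
      rw [← map_ofNat C 3]
      intro h0
      have h1 := (MvPolynomial.C_injective (Fin 4) Z3loc) (h0.trans C_0.symm)
      have h2 : ((3 : ℕ) : Z3loc) = 0 := (Nat.cast_ofNat (R := Z3loc) (n := 3)).trans h1
      rw [Nat.cast_eq_zero] at h2
      exact absurd h2 (by norm_num))
    rw [hg]; ring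
  rw [Ideal.Quotient.eq_zero_iff_mem, Ideal.mem_span_singleton]
  exact ⟨g', h5⟩

theorem isUnit_natCast_R {m : ℕ} (hm : ¬ 3 ∣ m) : IsUnit (m : Rring) := by
  have := (Z3loc_isUnit hm).map (algebraMap Z3loc Rring)
  simpa using this

/-- `p` holds for `x` once it holds for a nonzero integer multiple. -/
theorem sat_induction {p : Rring → Prop} (h3 : ∀ x, p (3 * x) → p x)
    (hu : ∀ (a : Z3loc) x, p x → p (algebraMap Z3loc Rring a * x))
    {n : ℕ} (hn : n ≠ 0) {x : Rring} (hx : p (n * x)) : p x := by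
  obtain ⟨k, m, hm, rfl⟩ := Nat.exists_eq_pow_mul_and_not_dvd hn 3 (by norm_num)
  have hpow : ∀ k : ℕ, ∀ y : Rring, p (3 ^ k * y) → p y := by
    intro k
    induction k with
    | zero => intro y hy; simpa using hy
    | succ k ih =>
      intro y hy
      apply ih
      apply h3
      convert hy using 1
      ring
  obtain ⟨u, hu1⟩ := Z3loc_isUnit hm
  have h1 : p (m * x) := by
    apply hpow k
    convert hx using 1
    push_cast
    ring
  have h2 := hu (↑u⁻¹) _ h1
  convert h2 using 1
  rw [← mul_assoc, show (m : Rring) = algebraMap Z3loc Rring (u : Z3loc) by rw [hu1]; simp,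
    ← map_mul]
  simp

theorem nat_torsion {n : ℕ} (hn : n ≠ 0) {x : Rring} (h : (n : Rring) * x = 0) : x = 0 := by
  refine sat_induction (p := fun x => x = 0) (fun x => three_torsion) ?_ hn h
  rintro a x rfl
  simp

theorem nat_cancel {n : ℕ} (hn : n ≠ 0) {x y : Rring} (h : (n : Rring) * x = n * y) : x = y := by
  rw [← sub_eq_zero]
  apply nat_torsion hn
  rw [mul_sub, h, sub_self]

theorem four_la2 : 4 * la2 = (zR 0 - zR 1 + zR 2) ^ 2 - 4 * (zR 1 * zR 2) - 12 * zR 3 := by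
  have h4 : IsUnit (4 : Rring) := by exact_mod_cast isUnit_natCast_R (m := 4) (by norm_num)
  have := Ring.mul_inverse_cancel _ h4
  unfold la2
  linear_combination (zR 0 - zR 1 + zR 2) ^ 2 * this

theorem two_la4 : 2 * la4 = zR 0 * zR 2 ^ 2 * (zR 0 - zR 1 + zR 2)
    - zR 3 * (4 * la2) - 6 * zR 3 ^ 2 := by
  have h2 : IsUnit (2 : Rring) := by exact_mod_cast isUnit_natCast_R (m := 2) (by norm_num)
  have := Ring.mul_inverse_cancel _ h2
  unfold la4
  linear_combination (zR 0 * zR 2 ^ 2 * (zR 0 - zR 1 + zR 2)) * this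

theorem four_la6 : 4 * la6 = zR 0 ^ 2 * zR 2 ^ 4
    - 2 * zR 3 * (2 * la4) - zR 3 ^ 2 * (4 * la2) - 4 * zR 3 ^ 3 := by
  have h4 : IsUnit (4 : Rring) := by exact_mod_cast isUnit_natCast_R (m := 4) (by norm_num)
  have := Ring.mul_inverse_cancel _ h4
  unfold la6
  linear_combination (zR 0 ^ 2 * zR 2 ^ 4) * this


/-! ### Polynomial identities -/

section Identities

variable {A : Type*} [CommRing A]

theorem nu4_identity (z1 z2 z3 r : A) (h : z1 * z2 + z2 * z3 + z3 * z1 = 0) :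
    12 * ((z1 + z2 + z3) ^ 2 * r - z1 ^ 3 * z3 - z1 * z2 ^ 3 - z1 ^ 2 * z3 ^ 2) + ((z1 - z2 + z3) ^ 2 - 4 * (z2 * z3) - 12 * r) * (z1 + z2 + z3) ^ 2 =
    (z1 + z2 + z3) ^ 4 + 24 * (z1 + z2 + z3) * (z1 * z2 * z3) + 8 * (z1 + z2 + z3) * (z1 ^ 2 * z2 + z2 ^ 2 * z3 + z3 ^ 2 * z1) := by
  linear_combination ((-8)*z3^2 + (-24)*z2*z3 + (-16)*z2^2 + (-20)*z1*z3 + (-16)*z1*z2 + (-12)*z1^2) * h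

theorem nu6_identity (z1 z2 z3 r : A) (h : z1 * z2 + z2 * z3 + z3 * z1 = 0) :
    144 * ((z1 + z2 + z3) ^ 2 * r ^ 2 - 2 * z1 ^ 3 * z3 * r - 2 * z1 * z2 ^ 3 * r
    - 2 * z1 ^ 2 * z3 ^ 2 * r + 2 * z1 ^ 3 * z3 ^ 3 - z1 ^ 2 * z3 ^ 4) - (z1 + z2 + z3) ^ 2 * ((z1 - z2 + z3) ^ 2 - 4 * (z2 * z3) - 12 * r) ^ 2
    + 2 * ((z1 - z2 + z3) ^ 2 - 4 * (z2 * z3) - 12 * r) * (12 * ((z1 + z2 + z3) ^ 2 * r - z1 ^ 3 * z3 - z1 * z2 ^ 3 - z1 ^ 2 * z3 ^ 2) + ((z1 - z2 + z3) ^ 2 - 4 * (z2 * z3) - 12 * r) * (z1 + z2 + z3) ^ 2) =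
    (z1 + z2 + z3) ^ 6 + 128 * (z1 + z2 + z3) ^ 3 * (z1 * z2 * z3) + 432 * (z1 * z2 * z3) ^ 2 + 16 * (z1 + z2 + z3) ^ 3 * (z1 ^ 2 * z2 + z2 ^ 2 * z3 + z3 ^ 2 * z1) + 48 * (z1 * z2 * z3) * (z1 ^ 2 * z2 + z2 ^ 2 * z3 + z3 ^ 2 * z1) := by
  linear_combination ((-16)*z3^4 + (-16)*z2*z3^3 + (-16)*z2^2*z3^2 + (-48)*z2^3*z3 + (-32)*z2^4 + (-216)*z1*z3^3 + (-480)*z1*z2*z3^2 + (-488)*z1*z2^2*z3 + (16)*z1*z2^3 + (168)*z1^2*z3^2 + (-480)*z1^2*z2*z3 + (-88)*z1^2*z2^2 + (-88)*z1^3*z3 + (-64)*z1^3*z2 + (-24)*z1^4) * h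

theorem c4_identity (z1 z2 z3 r : A) (h : z1 * z2 + z2 * z3 + z3 * z1 = 0) :
    ((z1 - z2 + z3) ^ 2 - 4 * (z2 * z3) - 12 * r) ^ 2 - 24 * (z1 * z3 ^ 2 * (z1 - z2 + z3) - r * ((z1 - z2 + z3) ^ 2 - 4 * (z2 * z3) - 12 * r) - 6 * r ^ 2) =
    (z1 + z2 + z3) ^ 4 - 16 * (z1 + z2 + z3) * (z1 * z2 * z3) - 8 * (z1 + z2 + z3) * (z1 ^ 2 * z2 + z2 ^ 2 * z3 + z3 ^ 2 * z1) := by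
  linear_combination ((-16)*z3^2 + (40)*z2*z3 + (-8)*z2^2 + (-16)*z1*z3 + (8)*z1*z2) * h

theorem c6_identity (z1 z2 z3 r : A) (h : z1 * z2 + z2 * z3 + z3 * z1 = 0) :
    -((z1 - z2 + z3) ^ 2 - 4 * (z2 * z3) - 12 * r) ^ 3 + 36 * ((z1 - z2 + z3) ^ 2 - 4 * (z2 * z3) - 12 * r) * (z1 * z3 ^ 2 * (z1 - z2 + z3) - r * ((z1 - z2 + z3) ^ 2 - 4 * (z2 * z3) - 12 * r) - 6 * r ^ 2) - 216 * (z1 ^ 2 * z3 ^ 4 - 2 * r * (z1 * z3 ^ 2 * (z1 - z2 + z3) - r * ((z1 - z2 + z3) ^ 2 - 4 * (z2 * z3) - 12 * r) - 6 * r ^ 2) - r ^ 2 * ((z1 - z2 + z3) ^ 2 - 4 * (z2 * z3) - 12 * r) - 4 * r ^ 3) =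
    -(z1 + z2 + z3) ^ 6 + 48 * (z1 + z2 + z3) ^ 3 * (z1 * z2 * z3) + 120 * (z1 * z2 * z3) ^ 2 + 12 * (z1 + z2 + z3) ^ 3 * (z1 ^ 2 * z2 + z2 ^ 2 * z3 + z3 ^ 2 * z1) + 8 * (z1 * z2 * z3) * (z1 ^ 2 * z2 + z2 ^ 2 * z3 + z3 ^ 2 * z1) := by
  linear_combination ((24)*z3^4 + (-108)*z2*z3^3 + (236)*z2^2*z3^2 + (-132)*z2^3*z3 + (12)*z2^4 + (-144)*z1*z3^3 + (-332)*z1*z2*z3^2 + (-16)*z1*z2^2*z3 + (-12)*z1*z2^3 + (72)*z1^2*z3^2 + (-252)*z1^2*z2*z3 + (4)*z1^2*z2^2 + (24)*z1^3*z3 + (-36)*z1^3*z2) * h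

theorem delta_identity (z1 z2 z3 : A) (h : z1 * z2 + z2 * z3 + z3 * z1 = 0) :
    (z1 ^ 2 * z2 + z2 ^ 2 * z3 + z3 ^ 2 * z1) ^ 2 + 3 * (z1 * z2 * z3) * (z1 ^ 2 * z2 + z2 ^ 2 * z3 + z3 ^ 2 * z1)
      + (z1 + z2 + z3) ^ 3 * (z1 * z2 * z3) + 9 * (z1 * z2 * z3) ^ 2 = 0 := by
  linear_combination ((1)*z2^3*z3 + (1)*z1*z3^3 + (5)*z1*z2*z3^2 + (5)*z1*z2^2*z3 + (5)*z1^2*z2*z3 + (1)*z1^3*z2) * h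

end Identities

/-- `δ = z₁²z₂ + z₂²z₃ + z₃²z₁`. -/
noncomputable def δR : Rring := zR 0 ^ 2 * zR 1 + zR 1 ^ 2 * zR 2 + zR 2 ^ 2 * zR 0

noncomputable def c4R : Rring := 16 * la2 ^ 2 - 48 * la4
noncomputable def c6R : Rring := -64 * la2 ^ 3 + 288 * la2 * la4 - 864 * la6
noncomputable def ν4R : Rring := 12 * n4R + 4 * la2 * σ₁R ^ 2
noncomputable def ν6R : Rring := 144 * n6R - 16 * σ₁R ^ 2 * la2 ^ 2 + 8 * la2 * ν4R

theorem c4R_eq : c4R = σ₁R ^ 4 - 16 * σ₁R * σ₃R - 8 * σ₁R * δR := by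
  have h := c4_identity (zR 0) (zR 1) (zR 2) (zR 3) e2_rel
  rw [← four_la2, ← two_la4] at h
  unfold c4R σ₁R σ₃R δR
  rw [← h]
  ring

theorem c6R_eq : c6R = -σ₁R ^ 6 + 48 * σ₁R ^ 3 * σ₃R + 120 * σ₃R ^ 2 + 12 * σ₁R ^ 3 * δR + 8 * σ₃R * δR := by
  have h := c6_identity (zR 0) (zR 1) (zR 2) (zR 3) e2_rel
  rw [← four_la2, ← two_la4, ← four_la6] at h
  unfold c6R σ₁R σ₃R δR
  rw [← h]
  ring

theorem ν4R_eq : ν4R = σ₁R ^ 4 + 24 * σ₁R * σ₃R + 8 * σ₁R * δR := by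
  have h := nu4_identity (zR 0) (zR 1) (zR 2) (zR 3) e2_rel
  rw [← four_la2] at h
  unfold ν4R n4R σ₁R σ₃R δR
  exact h

theorem ν6R_eq : ν6R = σ₁R ^ 6 + 128 * σ₁R ^ 3 * σ₃R + 432 * σ₃R ^ 2 + 16 * σ₁R ^ 3 * δR + 48 * σ₃R * δR := by
  have h := nu6_identity (zR 0) (zR 1) (zR 2) (zR 3) e2_rel
  rw [← four_la2] at h
  unfold ν6R ν4R n6R n4R σ₁R σ₃R δR
  rw [← h]
  ring

theorem δR_rel : δR ^ 2 + 3 * σ₃R * δR + σ₁R ^ 3 * σ₃R + 9 * σ₃R ^ 2 = 0 :=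
  delta_identity (zR 0) (zR 1) (zR 2) e2_rel


/-! ### The saturation `N` of the span `M` -/

/-- membership in the `Ã`-span of the eight elements. -/
def InM (x : Rring) : Prop := ∃ c : Fin 8 → Atilde, x = ∑ i : Fin 8, lam (c i) * basis8 i

/-- membership in the saturation of the span. -/
def InN (x : Rring) : Prop := ∃ n : ℕ, n ≠ 0 ∧ InM ((n : Rring) * x)

theorem InM.add {x y : Rring} (hx : InM x) (hy : InM y) : InM (x + y) := by
  obtain ⟨c, rfl⟩ := hx
  obtain ⟨d, rfl⟩ := hy
  refine ⟨fun i => c i + d i, ?_⟩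
  rw [← Finset.sum_add_distrib]
  refine Finset.sum_congr rfl fun i _ => ?_
  rw [map_add, add_mul]

theorem InM.lam_mul (a : Atilde) {x : Rring} (hx : InM x) : InM (lam a * x) := by
  obtain ⟨c, rfl⟩ := hx
  refine ⟨fun i => a * c i, ?_⟩
  rw [Finset.mul_sum]
  refine Finset.sum_congr rfl fun i _ => ?_
  rw [map_mul, mul_assoc]

theorem InM.nat (n : ℕ) {x : Rring} (hx : InM x) : InM (n * x) := by
  have := InM.lam_mul (n : Atilde) hx
  rwa [map_natCast] at this

theorem inM_basis (i : Fin 8) : InM (basis8 i) := by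
  refine ⟨Pi.single i 1, ?_⟩
  rw [Finset.sum_eq_single i]
  · simp
  · intro j _ hj
    simp [Pi.single_eq_of_ne hj]
  · simp

theorem InM.inN {x : Rring} (hx : InM x) : InN x := ⟨1, one_ne_zero, by simpa using hx⟩

theorem InN.add {x y : Rring} (hx : InN x) (hy : InN y) : InN (x + y) := by
  obtain ⟨n, hn, hx⟩ := hx
  obtain ⟨m, hm, hy⟩ := hy
  refine ⟨n * m, mul_ne_zero hn hm, ?_⟩
  convert (hx.nat m).add (hy.nat n) using 1
  push_cast
  ring

theorem InN.lam_mul (a : Atilde) {x : Rring} (hx : InN x) : InN (lam a * x) := by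
  obtain ⟨n, hn, hx⟩ := hx
  refine ⟨n, hn, ?_⟩
  convert hx.lam_mul a using 1
  ring

theorem InN.int (m : ℤ) {x : Rring} (hx : InN x) : InN (m * x) := by
  have := InN.lam_mul (m : Atilde) hx
  rwa [map_intCast] at this

theorem InN.of_nat {n : ℕ} (hn : n ≠ 0) {x : Rring} (hx : InN (n * x)) : InN x := by
  obtain ⟨m, hm, hx⟩ := hx
  refine ⟨m * n, mul_ne_zero hm hn, ?_⟩
  convert hx using 1
  push_cast
  ring

theorem InN.zero : InN 0 := by
  have := InN.int 0 (inM_basis 0).inN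
  simpa using this

theorem InN.sum {ι : Type*} (s : Finset ι) (f : ι → Rring) (h : ∀ i ∈ s, InN (f i)) :
    InN (∑ i ∈ s, f i) := by
  classical
  induction s using Finset.induction_on with
  | empty => simpa using InN.zero
  | insert a s ha ih =>
    rw [Finset.sum_insert ha]
    exact (h a (Finset.mem_insert_self _ _)).add
      (ih fun i hi => h i (Finset.mem_insert_of_mem hi))

theorem InN.mul_of_basis {m : Rring} (hm : ∀ i, InN (m * basis8 i)) {x : Rring} (hx : InN x) :
    InN (m * x) := by
  obtain ⟨n, hn, c, hc⟩ := hx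
  refine InN.of_nat hn ?_
  have : (n : Rring) * (m * x) = ∑ i : Fin 8, lam (c i) * (m * basis8 i) := by
    rw [mul_left_comm, hc, Finset.mul_sum]
    refine Finset.sum_congr rfl fun i _ => ?_
    ring
  rw [this]
  exact InN.sum _ _ fun i _ => (hm i).lam_mul _

theorem lam_X0 : lam (X 0) = la2 := by simp [lam]
theorem lam_X1 : lam (X 1) = la4 := by simp [lam]
theorem lam_X2 : lam (X 2) = la6 := by simp [lam]

theorem InN.la2_mul {x : Rring} (hx : InN x) : InN (la2 * x) := by
  rw [← lam_X0]; exact hx.lam_mul _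

theorem inN_c4 {x : Rring} (hx : InN x) : InN (c4R * x) := by
  have : c4R = lam (16 * X 0 ^ 2 - 48 * X 1) := by
    simp only [map_sub, map_mul, map_pow, lam_X0, lam_X1, map_ofNat]; rfl
  rw [this]; exact hx.lam_mul _

theorem inN_c6 {x : Rring} (hx : InN x) : InN (c6R * x) := by
  have : c6R = lam (-64 * X 0 ^ 3 + 288 * X 0 * X 1 - 864 * X 2) := by
    simp only [map_sub, map_add, map_neg, map_mul, map_pow, lam_X0, lam_X1, lam_X2, map_ofNat]; rfl
  rw [this]; exact hx.lam_mul _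

theorem inN_one : InN 1 := (inM_basis 0).inN
theorem inN_s : InN (σ₁R ^ 2) := (inM_basis 1).inN
theorem inN_s2 : InN (σ₁R ^ 4) := (inM_basis 2).inN
theorem inN_n4 : InN n4R := (inM_basis 3).inN
theorem inN_sn4 : InN (σ₁R ^ 2 * n4R) := (inM_basis 4).inN
theorem inN_n6 : InN n6R := (inM_basis 5).inN
theorem inN_sn6 : InN (σ₁R ^ 2 * n6R) := (inM_basis 6).inN
theorem inN_t : InN (σ₃R ^ 2) := (inM_basis 7).inN

theorem inN_ν4 : InN ν4R := by
  have h := (inN_n4.int 12).add (inN_s.la2_mul.int 4)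
  convert h using 1
  unfold ν4R
  push_cast
  ring

theorem inN_sν4 : InN (σ₁R ^ 2 * ν4R) := by
  have h := (inN_sn4.int 12).add (inN_s2.la2_mul.int 4)
  convert h using 1
  unfold ν4R
  push_cast
  ring

theorem inN_ν6 : InN ν6R := by
  have h := ((inN_n6.int 144).add (inN_s.la2_mul.la2_mul.int (-16))).add (inN_ν4.la2_mul.int 8)
  convert h using 1
  unfold ν6R
  push_cast
  ring

theorem inN_sν6 : InN (σ₁R ^ 2 * ν6R) := by
  have h := ((inN_sn6.int 144).add (inN_s2.la2_mul.la2_mul.int (-16))).add (inN_sν4.la2_mul.int 8)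
  convert h using 1
  unfold ν6R
  push_cast
  ring


theorem inN_w1 : InN (σ₁R * σ₃R) := by
  refine InN.of_nat (n := 8) (by norm_num) ?_
  have h := (InN.add (InN.add (InN.int (1) (inN_c4 inN_one))
    (InN.int (-2) inN_s2))
    (InN.int (1) inN_ν4))
  convert h using 1
  push_cast
  simp only [c4R_eq, c6R_eq, ν4R_eq, ν6R_eq]
  linear_combination (0) * δR_rel

theorem inN_w2 : InN (σ₁R * δR) := by
  refine InN.of_nat (n := 8) (by norm_num) ?_
  have h := (InN.add (InN.add (InN.int (-3) (inN_c4 inN_one))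
    (InN.int (5) inN_s2))
    (InN.int (-2) inN_ν4))
  convert h using 1
  push_cast
  simp only [c4R_eq, c6R_eq, ν4R_eq, ν6R_eq]
  linear_combination (0) * δR_rel

theorem inN_w3 : InN (σ₃R * δR) := by
  refine InN.of_nat (n := 192) (by norm_num) ?_
  have h := (InN.add (InN.add (InN.add (InN.add (InN.int (-42) (inN_c6 inN_one))
    (InN.int (-47) (inN_c4 inN_s)))
    (InN.int (-6) inN_sν4))
    (InN.int (11) inN_ν6))
    (InN.int (288) inN_t))
  convert h using 1
  push_cast
  simp only [c4R_eq, c6R_eq, ν4R_eq, ν6R_eq]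
  linear_combination (0) * δR_rel

theorem inN_s3 : InN (σ₁R ^ 2 * σ₁R ^ 4) := by
  refine InN.of_nat (n := 12) (by norm_num) ?_
  have h := (InN.add (InN.add (InN.add (InN.add (InN.int (-6) (inN_c6 inN_one))
    (InN.int (-1) (inN_c4 inN_s)))
    (InN.int (6) inN_sν4))
    (InN.int (1) inN_ν6))
    (InN.int (288) inN_t))
  convert h using 1
  push_cast
  simp only [c4R_eq, c6R_eq, ν4R_eq, ν6R_eq]
  linear_combination (0) * δR_rel

theorem inN_s2nu4 : InN (σ₁R ^ 2 * (σ₁R ^ 2 * ν4R)) := by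
  refine InN.of_nat (n := 3) (by norm_num) ?_
  have h := (InN.add (InN.add (InN.add (InN.add (InN.int (-3) (inN_c4 (inN_c4 inN_one)))
    (InN.int (-28) (inN_c6 inN_s)))
    (InN.int (-27) (inN_c4 inN_s2)))
    (InN.int (-1) (inN_c4 inN_ν4)))
    (InN.int (6) inN_sν6))
  convert h using 1
  push_cast
  simp only [c4R_eq, c6R_eq, ν4R_eq, ν6R_eq]
  linear_combination ((128)*σ₁R^2) * δR_rel

theorem inN_s2nu6 : InN (σ₁R ^ 2 * (σ₁R ^ 2 * ν6R)) := by
  refine InN.of_nat (n := 12) (by norm_num) ?_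
  have h := (InN.add (InN.add (InN.add (InN.add (InN.add (InN.add (InN.int (11046) (inN_c6 (inN_c4 inN_one)))
    (InN.int (11577) (inN_c4 (inN_c4 inN_s))))
    (InN.int (-2184) (inN_c6 inN_s2)))
    (InN.int (1904) (inN_c6 inN_ν4)))
    (InN.int (1314) (inN_c4 inN_sν4)))
    (InN.int (-2113) (inN_c4 inN_ν6)))
    (InN.int (-197280) (inN_c4 inN_t)))
  convert h using 1
  push_cast
  simp only [c4R_eq, c6R_eq, ν4R_eq, ν6R_eq]
  linear_combination ((-226304)*σ₁R*σ₃R + (-49664)*σ₁R^4) * δR_rel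

theorem inN_st : InN (σ₁R ^ 2 * σ₃R ^ 2) := by
  refine InN.of_nat (n := 1632) (by norm_num) ?_
  have h := (InN.add (InN.add (InN.add (InN.add (InN.int (-18) (inN_c4 (inN_c4 inN_one)))
    (InN.int (-22) (inN_c6 inN_s)))
    (InN.int (5) (inN_c4 inN_s2)))
    (InN.int (-10) (inN_c4 inN_ν4)))
    (InN.int (1) inN_sν6))
  convert h using 1
  push_cast
  simp only [c4R_eq, c6R_eq, ν4R_eq, ν6R_eq]
  linear_combination ((512)*σ₁R^2) * δR_rel

theorem inN_tnu4 : InN (σ₃R ^ 2 * ν4R) := by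
  refine InN.of_nat (n := 96) (by norm_num) ?_
  have h := (InN.add (InN.add (InN.add (InN.add (InN.add (InN.add (InN.int (90) (inN_c6 (inN_c4 inN_one)))
    (InN.int (93) (inN_c4 (inN_c4 inN_s))))
    (InN.int (-20) (inN_c6 inN_s2)))
    (InN.int (16) (inN_c6 inN_ν4)))
    (InN.int (10) (inN_c4 inN_sν4)))
    (InN.int (-17) (inN_c4 inN_ν6)))
    (InN.int (-1728) (inN_c4 inN_t)))
  convert h using 1
  push_cast
  simp only [c4R_eq, c6R_eq, ν4R_eq, ν6R_eq]
  linear_combination ((-1792)*σ₁R*σ₃R + (-384)*σ₁R^4) * δR_rel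

theorem inN_tnu6 : InN (σ₃R ^ 2 * ν6R) := by
  refine InN.of_nat (n := 11424) (by norm_num) ?_
  have h := (InN.add (InN.add (InN.add (InN.add (InN.add (InN.add (InN.add (InN.add (InN.int (-136) (inN_c6 (inN_c6 inN_one)))
    (InN.int (-98) (inN_c4 (inN_c4 (inN_c4 inN_one)))))
    (InN.int (-218) (inN_c6 (inN_c4 inN_s))))
    (InN.int (201) (inN_c4 (inN_c4 inN_s2))))
    (InN.int (6) (inN_c4 (inN_c4 inN_ν4))))
    (InN.int (272) (inN_c6 inN_sν4)))
    (InN.int (68) (inN_c6 inN_ν6)))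
    (InN.int (149) (inN_c4 inN_sν6)))
    (InN.int (29376) (inN_c6 inN_t)))
  convert h using 1
  push_cast
  simp only [c4R_eq, c6R_eq, ν4R_eq, ν6R_eq]
  linear_combination ((-17408)*σ₃R^2 + (-53248)*σ₁R^3*δR + (-158720)*σ₁R^3*σ₃R + (-15104)*σ₁R^6) * δR_rel

theorem inN_tt : InN (σ₃R ^ 2 * σ₃R ^ 2) := by
  refine InN.of_nat (n := 1645056) (by norm_num) ?_
  have h := (InN.add (InN.add (InN.add (InN.add (InN.add (InN.add (InN.add (InN.add (InN.int (782) (inN_c6 (inN_c6 inN_one)))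
    (InN.int (28) (inN_c4 (inN_c4 (inN_c4 inN_one)))))
    (InN.int (837) (inN_c6 (inN_c4 inN_s))))
    (InN.int (-174) (inN_c4 (inN_c4 inN_s2))))
    (InN.int (144) (inN_c4 (inN_c4 inN_ν4))))
    (InN.int (102) (inN_c6 inN_sν4)))
    (InN.int (-153) (inN_c6 inN_ν6)))
    (InN.int (6) (inN_c4 inN_sν6)))
    (InN.int (-14688) (inN_c6 inN_t)))
  convert h using 1
  push_cast
  simp only [c4R_eq, c6R_eq, ν4R_eq, ν6R_eq]
  linear_combination ((8704)*σ₃R^2 + (-59392)*σ₁R^3*δR + (-244992)*σ₁R^3*σ₃R + (3072)*σ₁R^6) * δR_rel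

/-- multiplication by an element which preserves the modified basis preserves `N`. -/
theorem InN.mul_of {m : Rring} (h0 : InN m) (h1 : InN (m * σ₁R ^ 2)) (h2 : InN (m * σ₁R ^ 4))
    (h3 : InN (m * ν4R)) (h4 : InN (m * (σ₁R ^ 2 * ν4R))) (h5 : InN (m * ν6R))
    (h6 : InN (m * (σ₁R ^ 2 * ν6R))) (h7 : InN (m * σ₃R ^ 2)) {x : Rring} (hx : InN x) :
    InN (m * x) := by
  refine InN.mul_of_basis ?_ hx
  intro i
  fin_cases i
  · simpa [basis8] using h0
  · exact h1
  · exact h2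
  · refine InN.of_nat (n := 12) (by norm_num) ?_
    convert h3.add (h1.la2_mul.int (-4)) using 1
    simp [basis8, ν4R]
    ring
  · refine InN.of_nat (n := 12) (by norm_num) ?_
    convert h4.add (h2.la2_mul.int (-4)) using 1
    simp [basis8, ν4R]
    ring
  · refine InN.of_nat (n := 144) (by norm_num) ?_
    convert (h5.add (h1.la2_mul.la2_mul.int 16)).add (h3.la2_mul.int (-8)) using 1
    simp [basis8, ν6R]
    ring
  · refine InN.of_nat (n := 144) (by norm_num) ?_
    convert (h6.add (h2.la2_mul.la2_mul.int 16)).add (h4.la2_mul.int (-8)) using 1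
    simp [basis8, ν6R]
    ring
  · exact h7

theorem InN.s_mul {x : Rring} (hx : InN x) : InN (σ₁R ^ 2 * x) := by
  refine InN.mul_of inN_s ?_ inN_s3 inN_sν4 inN_s2nu4 inN_sν6 inN_s2nu6 inN_st hx
  convert inN_s2 using 1
  ring

theorem InN.t_mul {x : Rring} (hx : InN x) : InN (σ₃R ^ 2 * x) := by
  refine InN.mul_of inN_t ?_ ?_ inN_tnu4 ?_ inN_tnu6 ?_ inN_tt hx
  · convert inN_t.s_mul using 1
    ring
  · convert inN_t.s_mul.s_mul using 1
    ring
  · convert inN_tnu4.s_mul using 1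
    ring
  · convert inN_tnu6.s_mul using 1
    ring

theorem inN_w1ν4 : InN (σ₁R * σ₃R * ν4R) := by
  convert (inN_w1.s_mul.s_mul.add (inN_one.s_mul.t_mul.int 24)).add (inN_w3.s_mul.int 8) using 1
  rw [ν4R_eq]
  push_cast
  ring

theorem inN_w1ν6 : InN (σ₁R * σ₃R * ν6R) := by
  convert (((inN_w1.s_mul.s_mul.s_mul.add (inN_one.s_mul.s_mul.t_mul.int 128)).add
    (inN_w1.t_mul.int 432)).add (inN_w3.s_mul.s_mul.int 16)).add (inN_w2.t_mul.int 48) using 1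
  rw [ν6R_eq]
  push_cast
  ring

theorem InN.w_mul {x : Rring} (hx : InN x) : InN (σ₁R * σ₃R * x) := by
  refine InN.mul_of inN_w1 ?_ ?_ inN_w1ν4 ?_ inN_w1ν6 ?_ ?_ hx
  · convert inN_w1.s_mul using 1
    ring
  · convert inN_w1.s_mul.s_mul using 1
    ring
  · convert inN_w1ν4.s_mul using 1
    ring
  · convert inN_w1ν6.s_mul using 1
    ring
  · convert inN_w1.t_mul using 1
    ring


/-! ### The automorphism `τ` -/

/-- The hypotheses on `τ`. -/
structure IsTau (τ : Rring ≃ₐ[Z3loc] Rring) : Prop where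
  h1 : τ (zR 0) = -zR 2
  h2 : τ (zR 1) = -zR 0
  h3 : τ (zR 2) = -zR 1
  h4 : τ (zR 3) = zR 3 + zR 1 * zR 2

namespace IsTau

variable {τ : Rring ≃ₐ[Z3loc] Rring}

theorem σ1 (h : IsTau τ) : τ σ₁R = -σ₁R := by
  unfold σ₁R
  simp only [map_add, h.h1, h.h2, h.h3]
  ring

theorem σ3 (h : IsTau τ) : τ σ₃R = -σ₃R := by
  unfold σ₃R
  simp only [map_mul, h.h1, h.h2, h.h3]
  ring

theorem δ (h : IsTau τ) : τ δR = -δR := by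
  unfold δR
  simp only [map_add, map_mul, map_pow, h.h1, h.h2, h.h3]
  ring

theorem la2 (h : IsTau τ) : τ la2 = la2 := by
  apply nat_cancel (n := 4) (by norm_num)
  have h4 := congrArg τ four_la2
  simp only [map_add, map_sub, map_mul, map_pow, h.h1, h.h2, h.h3, h.h4, map_ofNat] at h4
  push_cast
  rw [h4, four_la2]
  linear_combination (-4) * e2_rel

theorem c4 (h : IsTau τ) : τ c4R = c4R := by
  rw [c4R_eq]
  simp only [map_add, map_sub, map_mul, map_pow, h.σ1, h.σ3, h.δ, map_ofNat]
  ring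

theorem c6 (h : IsTau τ) : τ c6R = c6R := by
  rw [c6R_eq]
  simp only [map_add, map_neg, map_mul, map_pow, h.σ1, h.σ3, h.δ, map_ofNat]
  ring

theorem ν4 (h : IsTau τ) : τ ν4R = ν4R := by
  rw [ν4R_eq]
  simp only [map_add, map_mul, map_pow, h.σ1, h.σ3, h.δ, map_ofNat]
  ring

theorem ν6 (h : IsTau τ) : τ ν6R = ν6R := by
  rw [ν6R_eq]
  simp only [map_add, map_mul, map_pow, h.σ1, h.σ3, h.δ, map_ofNat]
  ring

theorem la4 (h : IsTau τ) : τ la4 = la4 := by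
  apply nat_cancel (n := 48) (by norm_num)
  have h4 := h.c4
  unfold c4R at h4
  simp only [map_sub, map_mul, map_pow, h.la2, map_ofNat] at h4
  push_cast
  linear_combination - h4

theorem la6 (h : IsTau τ) : τ la6 = la6 := by
  apply nat_cancel (n := 864) (by norm_num)
  have h4 := h.c6
  unfold c6R at h4
  simp only [map_sub, map_add, map_mul, map_neg, map_pow, h.la2, h.la4, map_ofNat] at h4
  push_cast
  linear_combination - h4

theorem n4 (h : IsTau τ) : τ n4R = n4R := by
  apply nat_cancel (n := 12) (by norm_num)
  have h4 := h.ν4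
  unfold ν4R at h4
  simp only [map_add, map_mul, map_pow, h.la2, h.σ1, map_ofNat] at h4
  push_cast
  linear_combination h4

theorem n6 (h : IsTau τ) : τ n6R = n6R := by
  apply nat_cancel (n := 144) (by norm_num)
  have h4 := h.ν6
  unfold ν6R at h4
  simp only [map_add, map_sub, map_mul, map_pow, h.la2, h.σ1, h.ν4, map_ofNat] at h4
  push_cast
  linear_combination h4

theorem lam (h : IsTau τ) (c : Atilde) : τ (lam c) = lam c := by
  have : (τ : Rring →ₐ[Z3loc] Rring).comp _root_.lam = _root_.lam := by
    apply MvPolynomial.algHom_ext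
    intro i
    fin_cases i
    · simpa [lam_X0] using h.la2
    · simpa [lam_X1] using h.la4
    · simpa [lam_X2] using h.la6
  exact DFunLike.congr_fun this c

theorem basis (h : IsTau τ) (i : Fin 8) : τ (basis8 i) = basis8 i := by
  fin_cases i <;> simp [basis8, h.σ1, h.σ3, h.n4, h.n6] <;> ring

theorem of_inM (h : IsTau τ) {x : Rring} (hx : InM x) : τ x = x := by
  obtain ⟨c, rfl⟩ := hx
  rw [map_sum]
  refine Finset.sum_congr rfl fun i _ => ?_
  rw [map_mul, h.lam, h.basis]

end IsTau

/-- The trace of the cyclic group of order six generated by `τ`. -/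
noncomputable def Tr (τ : Rring ≃ₐ[Z3loc] Rring) (x : Rring) : Rring :=
  x + τ x + τ (τ x) + τ (τ (τ x)) + τ (τ (τ (τ x))) + τ (τ (τ (τ (τ x))))

section Trace

variable {τ : Rring ≃ₐ[Z3loc] Rring}

theorem Tr_add (x y : Rring) : Tr τ (x + y) = Tr τ x + Tr τ y := by
  simp only [Tr, map_add]
  ring

theorem Tr_mul {m : Rring} (hm : τ m = m) (x : Rring) : Tr τ (m * x) = m * Tr τ x := by
  simp only [Tr, map_mul, hm]
  ring

def Good (τ : Rring ≃ₐ[Z3loc] Rring) (x : Rring) : Prop :=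
  InN (Tr τ x) ∧ InN (Tr τ (σ₁R * x)) ∧ InN (Tr τ (σ₃R * x))

theorem Good.add {x y : Rring} (hx : Good τ x) (hy : Good τ y) : Good τ (x + y) := by
  refine ⟨?_, ?_, ?_⟩
  · rw [Tr_add]; exact hx.1.add hy.1
  · rw [mul_add, Tr_add]; exact hx.2.1.add hy.2.1
  · rw [mul_add, Tr_add]; exact hx.2.2.add hy.2.2

theorem Good.lam_mul (h : IsTau τ) (a : Atilde) {x : Rring} (hx : Good τ x) :
    Good τ (lam a * x) := by
  refine ⟨?_, ?_, ?_⟩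
  · rw [Tr_mul (h.lam a)]; exact hx.1.lam_mul a
  · rw [mul_left_comm, Tr_mul (h.lam a)]; exact hx.2.1.lam_mul a
  · rw [mul_left_comm, Tr_mul (h.lam a)]; exact hx.2.2.lam_mul a

theorem Good.int (h : IsTau τ) (m : ℤ) {x : Rring} (hx : Good τ x) : Good τ (m * x) := by
  have := hx.lam_mul h (m : Atilde)
  rwa [map_intCast] at this

theorem Good.of_nat {n : ℕ} (hn : n ≠ 0) {x : Rring} (hx : Good τ (n * x)) :
    Good τ x := by
  have hf : τ (n : Rring) = n := map_natCast _ _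
  obtain ⟨a, b, c⟩ := hx
  rw [Tr_mul hf] at a
  rw [mul_left_comm, Tr_mul hf] at b c
  exact ⟨a.of_nat hn, b.of_nat hn, c.of_nat hn⟩

theorem Good.s1_mul (h : IsTau τ) {x : Rring} (hx : Good τ x) : Good τ (σ₁R * x) := by
  refine ⟨hx.2.1, ?_, ?_⟩
  · rw [← mul_assoc, ← pow_two, Tr_mul (by rw [map_pow, h.σ1]; ring)]
    exact hx.1.s_mul
  · rw [← mul_assoc, mul_comm σ₃R, Tr_mul (by rw [map_mul, h.σ1, h.σ3]; ring)]
    exact hx.1.w_mul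

theorem Good.s3_mul (h : IsTau τ) {x : Rring} (hx : Good τ x) : Good τ (σ₃R * x) := by
  refine ⟨hx.2.2, ?_, ?_⟩
  · rw [← mul_assoc, Tr_mul (by rw [map_mul, h.σ1, h.σ3]; ring)]
    exact hx.1.w_mul
  · rw [← mul_assoc, ← pow_two, Tr_mul (by rw [map_pow, h.σ3]; ring)]
    exact hx.1.t_mul

structure VG (τ : Rring ≃ₐ[Z3loc] Rring) (x : Rring) : Prop where
  g0 : Good τ x
  g1 : Good τ (zR 0 * x)
  g2 : Good τ (zR 0 ^ 2 * x)
  g3 : Good τ (zR 1 * x)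
  g4 : Good τ (zR 0 * zR 1 * x)
  g5 : Good τ (zR 0 ^ 2 * zR 1 * x)

theorem VG.add {x y : Rring} (hx : VG τ x) (hy : VG τ y) : VG τ (x + y) := by
  constructor <;> try simp only [mul_add]
  exacts [hx.g0.add hy.g0, hx.g1.add hy.g1, hx.g2.add hy.g2, hx.g3.add hy.g3, hx.g4.add hy.g4,
    hx.g5.add hy.g5]

theorem VG.map {x m : Rring} (hm : ∀ y, Good τ y → Good τ (m * y)) (hx : VG τ x) :
    VG τ (m * x) := by
  constructor <;> try simp only [mul_left_comm _ m]
  exacts [hm _ hx.g0, hm _ hx.g1, hm _ hx.g2, hm _ hx.g3, hm _ hx.g4, hm _ hx.g5]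

theorem VG.of_nat {n : ℕ} (hn : n ≠ 0) {x : Rring} (hx : VG τ (n * x)) : VG τ x := by
  obtain ⟨a, b, c, d, e, f⟩ := hx
  rw [mul_left_comm] at b c d e f
  exact ⟨a.of_nat hn, b.of_nat hn, c.of_nat hn, d.of_nat hn, e.of_nat hn, f.of_nat hn⟩

theorem VG.int (h : IsTau τ) (m : ℤ) {x : Rring} (hx : VG τ x) : VG τ (m * x) :=
  hx.map fun _ hy => hy.int h m

theorem VG.s1_mul (h : IsTau τ) {x : Rring} (hx : VG τ x) : VG τ (σ₁R * x) :=
  hx.map fun _ hy => hy.s1_mul h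

theorem VG.lam_mul (h : IsTau τ) (a : Atilde) {x : Rring} (hx : VG τ x) : VG τ (lam a * x) :=
  hx.map fun _ hy => hy.lam_mul h a

theorem z1_cubic : zR 0 ^ 3 = σ₁R * zR 0 ^ 2 + σ₃R := by
  unfold σ₁R σ₃R
  linear_combination (- zR 0) * e2_rel

theorem z2_quad : zR 1 ^ 2 = σ₁R * zR 0 + σ₁R * zR 1 - zR 0 ^ 2 - zR 0 * zR 1 := by
  unfold σ₁R
  linear_combination (-1) * e2_rel

theorem VG.z1_mul (h : IsTau τ) {x : Rring} (hx : VG τ x) : VG τ (zR 0 * x) := by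
  refine ⟨hx.g1, ?_, ?_, ?_, ?_, ?_⟩
  · convert hx.g2 using 1
    ring
  · convert (hx.g2.s1_mul h).add (hx.g0.s3_mul h) using 1
    linear_combination x * z1_cubic
  · convert hx.g4 using 1
    ring
  · convert hx.g5 using 1
    ring
  · convert (hx.g5.s1_mul h).add (hx.g3.s3_mul h) using 1
    linear_combination x * zR 1 * z1_cubic

theorem VG.z2_mul (h : IsTau τ) {x : Rring} (hx : VG τ x) : VG τ (zR 1 * x) := by
  have hy := hx.z1_mul h
  have hz := hy.z1_mul h
  -- the quadratic relation, for any good module element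
  have key : ∀ y, VG τ y → Good τ (zR 1 * (zR 1 * y)) := by
    intro y hy
    convert (((hy.g1.s1_mul h).add (hy.g3.s1_mul h)).add (hy.g2.int h (-1))).add
      (hy.g4.int h (-1)) using 1
    push_cast
    linear_combination y * z2_quad
  refine ⟨hx.g3, ?_, ?_, key x hx, ?_, ?_⟩
  · convert hx.g4 using 1
    ring
  · convert hx.g5 using 1
    ring
  · convert key _ hy using 1
    ring
  · convert key _ hz using 1
    ring

theorem VG.z3_mul (h : IsTau τ) {x : Rring} (hx : VG τ x) : VG τ (zR 2 * x) := by
  convert ((hx.s1_mul h).add ((hx.z1_mul h).int h (-1))).add ((hx.z2_mul h).int h (-1)) using 1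
  unfold σ₁R
  push_cast
  ring

theorem VG.r_mul (h : IsTau τ) {x : Rring} (hx : VG τ x) : VG τ (zR 3 * x) := by
  refine VG.of_nat (n := 12) (by norm_num) ?_
  have hl : VG τ (la2 * x) := by rw [← lam_X0]; exact hx.lam_mul h _
  have hz3 := hx.z3_mul h
  convert ((((hx.s1_mul h).s1_mul h).add ((hz3.z1_mul h).int h 4)).add
    ((hz3.z2_mul h).int h (-4))).add (hl.int h (-4)) using 1
  unfold σ₁R
  push_cast
  linear_combination x * four_la2 - 4 * x * e2_rel

theorem InN.two {x : Rring} (hx : InN x) : InN (2 * x) := by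
  have := hx.int 2
  exact_mod_cast this

theorem VG_one (h : IsTau τ) : VG τ 1 := by
  have e := e2_rel
  have z0 : InN 0 := InN.zero
  have one2 := inN_one.two
  refine ⟨⟨?_, ?_, ?_⟩, ⟨?_, ?_, ?_⟩, ⟨?_, ?_, ?_⟩, ⟨?_, ?_, ?_⟩, ⟨?_, ?_, ?_⟩, ⟨?_, ?_, ?_⟩⟩
  · convert inN_one.int 6 using 1
    simp [Tr]; ring
  all_goals simp only [Tr, map_mul, map_neg, map_pow, map_one, h.σ1, h.σ3, h.h1, h.h2, h.h3, mul_one]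
  · convert z0 using 1
    ring
  · convert z0 using 1
    ring
  · convert z0 using 1
    ring
  · convert inN_s.int 2 using 1
    unfold σ₁R
    push_cast
    ring
  · convert inN_w1.int 2 using 1
    unfold σ₁R σ₃R
    push_cast
    ring
  · convert inN_s.int 2 using 1
    unfold σ₁R
    push_cast
    linear_combination (-4) * e
  · convert z0 using 1
    ring
  · convert z0 using 1
    ring
  · convert z0 using 1
    ring
  · convert inN_s.int 2 using 1
    unfold σ₁R
    push_cast
    ring
  · convert inN_w1.int 2 using 1
    unfold σ₁R σ₃R
    push_cast
    ring
  · convert z0 using 1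
    linear_combination 2 * e
  · convert z0 using 1
    ring
  · convert z0 using 1
    ring
  · convert z0 using 1
    ring
  · convert inN_w2.int 2 using 1
    unfold δR
    push_cast
    ring
  · convert inN_w3.int 2 using 1
    unfold δR
    push_cast
    ring

theorem VG_all (h : IsTau τ) (x : Rring) : VG τ x := by
  obtain ⟨f, rfl⟩ := Ideal.Quotient.mk_surjective x
  induction f using MvPolynomial.induction_on with
  | C a =>
    have h1 := (VG_one h).lam_mul h (C a)
    convert h1 using 1
    rw [mul_one, ← MvPolynomial.algebraMap_eq, ← MvPolynomial.algebraMap_eq, AlgHom.commutes]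
    rfl
  | add p q hp hq => rw [map_add]; exact hp.add hq
  | mul_X p i hp =>
    rw [map_mul, mul_comm]
    fin_cases i
    · exact hp.z1_mul h
    · exact hp.z2_mul h
    · exact hp.z3_mul h
    · exact hp.r_mul h

theorem inN_of_fixed (h : IsTau τ) {x : Rring} (hx : τ x = x) : InN x := by
  have h1 := (VG_all h x).g0.1
  refine InN.of_nat (n := 6) (by norm_num) ?_
  convert h1 using 1
  simp only [Tr, hx]
  push_cast
  ring

end Trace


/-! ### Identities in characteristic three -/

theorem m3_s1 {F : Type*} [Field F] (h3 : (3 : F) = 0) {u b v z1 z2 z3 : F}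
    (hv : v = b * u ^ 2 - b ^ 3) (hz1 : z1 = b * (u + 2 * b)) (hz2 : z2 = (u + b) * (u + 2 * b))
    (hz3 : z3 = -((u + b) * b)) :
    z1 + z2 + z3 = u ^ 2 := by
  subst hv hz1 hz2 hz3
  linear_combination ((1)*u^0*b^2 + (1)*u^1*b^1) * h3

theorem m3_s3 {F : Type*} [Field F] (h3 : (3 : F) = 0) {u b v z1 z2 z3 : F}
    (hv : v = b * u ^ 2 - b ^ 3) (hz1 : z1 = b * (u + 2 * b)) (hz2 : z2 = (u + b) * (u + 2 * b))
    (hz3 : z3 = -((u + b) * b)) :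
    z1 * z2 * z3 = -v ^ 2 := by
  subst hv hz1 hz2 hz3
  linear_combination ((-1)*u^0*b^6 + (-4)*u^1*b^5 + (-5)*u^2*b^4 + (-2)*u^3*b^3) * h3

theorem m3_q {F : Type*} [Field F] (h3 : (3 : F) = 0) {u b v z1 z2 z3 : F}
    (hv : v = b * u ^ 2 - b ^ 3) (hz1 : z1 = b * (u + 2 * b)) (hz2 : z2 = (u + b) * (u + 2 * b))
    (hz3 : z3 = -((u + b) * b)) :
    (z1 - z2 + z3) ^ 2 - z2 * z3 = u ^ 4 + u * v := by
  subst hv hz1 hz2 hz3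
  linear_combination ((1)*u^0*b^4 + (4)*u^1*b^3 + (5)*u^2*b^2 + (2)*u^3*b^1) * h3

theorem m3_A0 {F : Type*} [Field F] (h3 : (3 : F) = 0) {u b v z1 z2 z3 : F}
    (hv : v = b * u ^ 2 - b ^ 3) (hz1 : z1 = b * (u + 2 * b)) (hz2 : z2 = (u + b) * (u + 2 * b))
    (hz3 : z3 = -((u + b) * b)) :
    ((z1 - z2 + z3) ^ 2 - z2 * z3) ^ 3 * (z1 ^ 2 * z3 ^ 4) + (-(z1 * z3 ^ 2 * (z1 - z2 + z3))) ^ 3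
      - ((z1 - z2 + z3) ^ 2 - z2 * z3) ^ 2 * (-(z1 * z3 ^ 2 * (z1 - z2 + z3))) ^ 2 = v ^ 7 * (u ^ 3 - v) := by
  subst hv hz1 hz2 hz3
  linear_combination ((27)*u^0*b^24 + (400)*u^1*b^23 + (2800)*u^2*b^22 + (12139)*u^3*b^21 + (36307)*u^4*b^20
       + (79358)*u^5*b^19 + (131148)*u^6*b^18 + (167207)*u^7*b^17 + (166287)*u^8*b^16
       + (129607)*u^9*b^15 + (79157)*u^10*b^14 + (37672)*u^11*b^13 + (13782)*u^12*b^12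
       + (3783)*u^13*b^11 + (755)*u^14*b^10 + (106)*u^15*b^9 + (9)*u^16*b^8) * h3

theorem m3_N4 {F : Type*} [Field F] (h3 : (3 : F) = 0) {u b v z1 z2 z3 : F}
    (hv : v = b * u ^ 2 - b ^ 3) (hz1 : z1 = b * (u + 2 * b)) (hz2 : z2 = (u + b) * (u + 2 * b))
    (hz3 : z3 = -((u + b) * b)) :
    (-z1 ^ 3 * z3 - z1 * z2 ^ 3 - z1 ^ 2 * z3 ^ 2) * ((z1 - z2 + z3) ^ 2 - z2 * z3)
      - u ^ 4 * (-(z1 * z3 ^ 2 * (z1 - z2 + z3))) = -(u ^ 9 * v + u ^ 3 * v ^ 3) := by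
  subst hv hz1 hz2 hz3
  linear_combination ((-12)*u^0*b^12 + (-116)*u^1*b^11 + (-487)*u^2*b^10 + (-1177)*u^3*b^9 + (-1817)*u^4*b^8
       + (-1886)*u^5*b^7 + (-1350)*u^6*b^6 + (-668)*u^7*b^5 + (-223)*u^8*b^4 + (-48)*u^9*b^3
       + (-6)*u^10*b^2) * h3

theorem m3_N6 {F : Type*} [Field F] (h3 : (3 : F) = 0) {u b v z1 z2 z3 : F}
    (hv : v = b * u ^ 2 - b ^ 3) (hz1 : z1 = b * (u + 2 * b)) (hz2 : z2 = (u + b) * (u + 2 * b))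
    (hz3 : z3 = -((u + b) * b)) :
    u ^ 4 * (-(z1 * z3 ^ 2 * (z1 - z2 + z3))) ^ 2
      - 2 * (-z1 ^ 3 * z3 - z1 * z2 ^ 3 - z1 ^ 2 * z3 ^ 2) * ((z1 - z2 + z3) ^ 2 - z2 * z3)
        * (-(z1 * z3 ^ 2 * (z1 - z2 + z3)))
      + (2 * z1 ^ 3 * z3 ^ 3 - z1 ^ 2 * z3 ^ 4) * ((z1 - z2 + z3) ^ 2 - z2 * z3) ^ 2
      = -u ^ 8 * v ^ 4 - u ^ 5 * v ^ 5 + u ^ 2 * v ^ 6 := by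
  subst hv hz1 hz2 hz3
  linear_combination ((-12)*u^0*b^20 + (12)*u^1*b^19 + (1054)*u^2*b^18 + (7458)*u^3*b^17 + (27795)*u^4*b^16
       + (67243)*u^5*b^15 + (114590)*u^6*b^14 + (143291)*u^7*b^13 + (134328)*u^8*b^12
       + (95318)*u^9*b^11 + (51243)*u^10*b^10 + (20718)*u^11*b^9 + (6188)*u^12*b^8
       + (1319)*u^13*b^7 + (189)*u^14*b^6 + (17)*u^15*b^5 + (1)*u^16*b^4) * h3


/-! ### Polynomial independence lemmas -/

theorem poly_indep {k : Type*} [Field k] {P Q : Polynomial k} (hc : IsCoprime Q P) (hQ : Q ≠ 0)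
    (D : ℕ) (G : ℕ → Polynomial k) (hG : ∀ j, (G j).degree < Q.degree)
    (h : ∑ j ∈ Finset.range (D + 1), G j * Q ^ j * P ^ (D - j) = 0) :
    ∀ j ≤ D, G j = 0 := by
  induction D generalizing G with
  | zero =>
    intro j hj
    obtain rfl : j = 0 := by omega
    simpa using h
  | succ D ih =>
    rw [Finset.sum_range_succ'] at h
    have hs : ∑ j ∈ Finset.range (D + 1), G (j + 1) * Q ^ (j + 1) * P ^ (D + 1 - (j + 1))
        = Q * ∑ j ∈ Finset.range (D + 1), G (j + 1) * Q ^ j * P ^ (D - j) := by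
      rw [Finset.mul_sum]
      refine Finset.sum_congr rfl fun j _ => ?_
      rw [Nat.add_sub_add_right]
      ring
    rw [hs] at h
    have hd : Q ∣ G 0 * P ^ (D + 1) := by
      refine ⟨-∑ j ∈ Finset.range (D + 1), G (j + 1) * Q ^ j * P ^ (D - j), ?_⟩
      simp only [pow_zero, mul_one, Nat.sub_zero] at h
      linear_combination h
    have h0 : G 0 = 0 :=
      Polynomial.eq_zero_of_dvd_of_degree_lt (hc.pow_right.dvd_of_dvd_mul_right hd) (hG 0)
    rw [h0] at h
    simp only [zero_mul, add_zero] at h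
    have h' := ih (fun j => G (j + 1)) (fun j => hG _) ((mul_eq_zero.1 h).resolve_left hQ)
    intro j hj
    cases j with
    | zero => exact h0
    | succ j => exact h' j (by omega)

theorem eval_indep {k F : Type*} [Field k] [Field F] (ι : Polynomial k →+* F)
    (hι : Function.Injective ι) {P Q : Polynomial k} (hc : IsCoprime Q P) (hQ : Q.degree = 8)
    {J : F} (hJ : J * ι P = ι Q) (e : Fin 8 → Polynomial k)
    (h : ∑ i : Fin 8, (e i).eval₂ (ι.comp Polynomial.C) J * ι Polynomial.X ^ (i : ℕ) = 0) :
    ∀ i, e i = 0 := by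
  have hQ0 : Q ≠ 0 := by
    rintro rfl
    simp at hQ
  obtain ⟨D, hD⟩ : ∃ D : ℕ, ∀ i, (e i).natDegree < D + 1 :=
    ⟨Finset.univ.sup fun i => (e i).natDegree, fun i =>
      Nat.lt_succ_of_le (Finset.le_sup (f := fun i => (e i).natDegree) (Finset.mem_univ i))⟩
  set G : ℕ → Polynomial k := fun j =>
    ∑ i : Fin 8, Polynomial.C ((e i).coeff j) * Polynomial.X ^ (i : ℕ) with hGdef
  have hG : ∀ j, (G j).degree < Q.degree := by
    intro j
    rw [hQ]
    refine lt_of_le_of_lt (Polynomial.degree_sum_le _ _) ?_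
    rw [Finset.sup_lt_iff (by exact WithBot.bot_lt_coe 8)]
    intro i _
    refine lt_of_le_of_lt (Polynomial.degree_C_mul_X_pow_le _ _) ?_
    exact_mod_cast i.2
  have key : ι (∑ j ∈ Finset.range (D + 1), G j * Q ^ j * P ^ (D - j)) = 0 := by
    have h2 := congrArg (fun y => y * ι P ^ D) h
    simp only [zero_mul] at h2
    rw [← h2, map_sum, Finset.sum_mul]
    simp only [hGdef, map_mul, map_sum, map_pow, Finset.sum_mul]
    rw [Finset.sum_comm]
    refine Finset.sum_congr rfl fun i _ => ?_
    rw [Polynomial.eval₂_eq_sum_range' _ (hD i), Finset.sum_mul, Finset.sum_mul]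
    refine Finset.sum_congr rfl fun j hj => ?_
    have hj' : j ≤ D := by
      have := Finset.mem_range.1 hj
      omega
    have : ι P ^ D = ι P ^ j * ι P ^ (D - j) := by rw [← pow_add]; congr 1; omega
    rw [this, ← hJ, mul_pow, RingHom.comp_apply]
    ring
  have hz := poly_indep hc hQ0 D G hG (hι (by rw [key, map_zero]))
  intro i
  ext j
  rw [Polynomial.coeff_zero]
  by_cases hj : j ≤ D
  · have := congrArg (fun p => Polynomial.coeff p (i : ℕ)) (hz j hj)
    simp only [hGdef, Polynomial.finsetSum_coeff, Polynomial.coeff_C_mul, Polynomial.coeff_X_pow,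
      Polynomial.coeff_zero] at this
    rw [Finset.sum_eq_single i] at this
    · simpa using this
    · intro b _ hb
      rw [if_neg, mul_zero]
      intro hh
      exact hb (Fin.ext hh.symm)
    · simp
  · exact Polynomial.coeff_eq_zero_of_natDegree_lt (by have := hD i; omega)

/-- the linear algebra over `𝔽₃` at the end of the argument. -/
theorem unmix {A : Type*} [CommRing A] (hc : (3 : A) = 0) {E : Fin 8 → A}
    (h0 : E 0 + E 1 + E 2 = 0)
    (h1 : -E 1 + E 2 + E 3 + E 4 = 0)
    (h2 : E 1 - E 4 = 0)
    (h3 : -E 0 + E 1 + E 2 + E 3 - E 4 = 0)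
    (h4 : -E 1 + E 2 + E 3 - E 4 - E 5 - E 6 + E 7 = 0)
    (h5 : E 1 + E 4 + E 5 - E 6 = 0)
    (h6 : E 0 + E 3 + E 6 = 0)
    (h7 : E 5 + E 7 = 0) :
    ∀ i, E i = 0 := by
  intro i
  fin_cases i
  · change E 0 = 0
    linear_combination h1 - h2 - h3 - (-E 1 + E 4) * hc
  · change E 1 = 0
    linear_combination h1 - h4 + h5 + h7 - (E 4 + E 5) * hc
  · change E 2 = 0
    linear_combination h0 + h1 + h2 + h3 + h4 - h5 - h7 - (E 2 + E 3 - E 4 - E 5) * hc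
  · change E 3 = 0
    linear_combination -h0 - h3 - h4 + h5 + h7 - (-E 2 - E 3 + E 4 + E 5) * hc
  · change E 4 = 0
    linear_combination h1 - h2 - h4 + h5 + h7 - (E 4 + E 5) * hc
  · change E 5 = 0
    linear_combination h0 - h2 - h3 + h5 + h6 - (E 0 + E 4) * hc
  · change E 6 = 0
    linear_combination h0 - h1 + h2 - h3 + h4 - h5 + h6 - h7 - (E 0 - E 4 - E 5) * hc
  · change E 7 = 0
    linear_combination -h0 + h2 + h3 - h5 - h6 + h7 - (-E 0 - E 4) * hc

theorem mix {A : Type*} [CommRing A] (h3 : (3 : A) = 0) (E : Fin 8 → A) (t : A) :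
    E 0 * (1 + t) ^ 6 + E 1 * (1 + t) ^ 5 + E 2 * (1 + t) ^ 4 + E 3 * (t + t ^ 3) * (1 + t) ^ 3
      + E 4 * (t + t ^ 3) * (1 + t) ^ 2 + E 5 * (t ^ 6 - t ^ 5 - t ^ 4) * (1 + t)
      + E 6 * (t ^ 6 - t ^ 5 - t ^ 4) + E 7 * t ^ 4 * (1 + t) ^ 3
    = (E 0 + E 1 + E 2) * t ^ 0
      + (-E 1 + E 2 + E 3 + E 4) * t ^ 1
      + (E 1 - E 4) * t ^ 2
      + (-E 0 + E 1 + E 2 + E 3 - E 4) * t ^ 3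
      + (-E 1 + E 2 + E 3 - E 4 - E 5 - E 6 + E 7) * t ^ 4
      + (E 1 + E 4 + E 5 - E 6) * t ^ 5
      + (E 0 + E 3 + E 6) * t ^ 6
      + (E 5 + E 7) * t ^ 7 := by
  linear_combination (E 0 * (2 * t ^ 1 + 5 * t ^ 2 + 7 * t ^ 3 + 5 * t ^ 4 + 2 * t ^ 5)
      + E 1 * (2 * t ^ 1 + 3 * t ^ 2 + 3 * t ^ 3 + 2 * t ^ 4)
      + E 2 * (t ^ 1 + 2 * t ^ 2 + t ^ 3)
      + E 3 * (t ^ 2 + t ^ 3 + t ^ 4 + t ^ 5)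
      + E 4 * (t ^ 2 + t ^ 3 + t ^ 4)
      + E 5 * (-t ^ 5)
      + E 7 * (t ^ 5 + t ^ 6)) * h3

def mixE {A : Type*} [CommRing A] (E : Fin 8 → A) : Fin 8 → A :=
    ![E 0 + E 1 + E 2,
      -E 1 + E 2 + E 3 + E 4,
      E 1 - E 4,
      -E 0 + E 1 + E 2 + E 3 - E 4,
      -E 1 + E 2 + E 3 - E 4 - E 5 - E 6 + E 7,
      E 1 + E 4 + E 5 - E 6,
      E 0 + E 3 + E 6,
      E 5 + E 7]


/-! ### A point of `R` over a field of characteristic three -/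

theorem exists_point {F : Type*} [Field F] (θ : ZMod 3 →+* F) (Z : Fin 4 → F)
    (hZ : Z 0 * Z 1 + Z 1 * Z 2 + Z 2 * Z 0 = 0) :
    ∃ φ : Rring →+* F, (∀ i, φ (zR i) = Z i) ∧
      ∀ a : Z3loc, φ (algebraMap Z3loc Rring a) = θ (red a) := by
  have hlift : ∀ a ∈ Ideal.span {(X 0 * X 1 + X 1 * X 2 + X 2 * X 0 : MvPolynomial (Fin 4) Z3loc)},
      MvPolynomial.eval₂Hom (θ.comp red) Z a = 0 := by
    intro a ha
    rw [Ideal.mem_span_singleton] at ha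
    obtain ⟨b, rfl⟩ := ha
    rw [map_mul]
    have : MvPolynomial.eval₂Hom (θ.comp red) Z (X 0 * X 1 + X 1 * X 2 + X 2 * X 0) = 0 := by
      simpa using hZ
    rw [this, zero_mul]
  refine ⟨Ideal.Quotient.lift _ (MvPolynomial.eval₂Hom (θ.comp red) Z) hlift, ?_, ?_⟩
  · intro i
    simp [zR]
  · intro a
    have : algebraMap Z3loc Rring a = Ideal.Quotient.mk _ (C a) := rfl
    rw [this]
    simp

/-- The polynomial in one variable attached to an element of `Ã`. -/
noncomputable def dpoly {k : Type*} [Field k] (θ : ZMod 3 →+* k) (x p : k) :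
    Atilde →+* Polynomial k :=
  MvPolynomial.eval₂Hom ((Polynomial.C.comp θ).comp red)
    ![Polynomial.C x, Polynomial.C (p * x),
      Polynomial.C (x ^ 3) * Polynomial.X + Polynomial.C (x * p ^ 2 - p ^ 3)]

/-- values of `λ(āᵢ)` and the basis elements at the point. -/
theorem point_values {F : Type*} [Field F] (h3 : (3 : F) = 0) (φ : Rring →+* F) {u b t x p J : F}
    (hx0 : x ≠ 0) (hu : u ^ 4 * (1 + t) = x) (hb : b * u ^ 2 - b ^ 3 = t * u ^ 3)
    (hJ : J * (1 + t) ^ 6 = t ^ 7 - t ^ 8)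
    (h0 : φ (zR 0) = b * (u + 2 * b)) (h1 : φ (zR 1) = (u + b) * (u + 2 * b))
    (h2 : φ (zR 2) = -((u + b) * b))
    (hr : φ (zR 3) * x = p * x + φ (zR 0) * φ (zR 2) ^ 2 * (φ (zR 0) - φ (zR 1) + φ (zR 2))) :
    φ la2 = x ∧ φ la4 = p * x ∧ φ la6 = x ^ 3 * J + (x * p ^ 2 - p ^ 3) ∧ φ σ₁R ^ 2 = u ^ 4 ∧
    φ n4R * x = u ^ 4 * p * x - u ^ 12 * (t + t ^ 3) ∧
    φ n6R * x ^ 2 = u ^ 4 * p ^ 2 * x ^ 2 - 2 * p * x * (u ^ 12 * (t + t ^ 3))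
      + u ^ 20 * (t ^ 6 - t ^ 5 - t ^ 4) ∧
    φ σ₃R ^ 2 = u ^ 12 * t ^ 4 := by
  have e2 := congrArg φ four_la2
  have e4 := congrArg φ two_la4
  have e6 := congrArg φ four_la6
  have i1 := m3_s1 h3 hb.symm h0 h1 h2
  have i3 := m3_s3 h3 hb.symm h0 h1 h2
  have iq := m3_q h3 hb.symm h0 h1 h2
  have iA := m3_A0 h3 hb.symm h0 h1 h2
  have iN4 := m3_N4 h3 hb.symm h0 h1 h2
  have iN6 := m3_N6 h3 hb.symm h0 h1 h2
  have n4 : φ n4R = _ := congrArg φ n4R.eq_1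
  have n6 : φ n6R = _ := congrArg φ n6R.eq_1
  have s1 : φ σ₁R = _ := congrArg φ σ₁R.eq_1
  have s3 : φ σ₃R = _ := congrArg φ σ₃R.eq_1
  simp only [map_mul, map_add, map_sub, map_pow, map_ofNat] at e2 e4 e6 n4 n6 s1 s3
  clear h0 h1 h2
  generalize φ (zR 0) = z1 at *
  generalize φ (zR 1) = z2 at *
  generalize φ (zR 2) = z3 at *
  generalize φ (zR 3) = r at *
  have hqx : (z1 - z2 + z3) ^ 2 - z2 * z3 = x := by
    rw [iq, ← hu]; ring
  have hq : φ la2 = x := by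
    linear_combination e2 + hqx + (-φ la2 - z2 * z3 - 4 * r) * h3
  rw [hqx] at iA iN4 iN6
  have hh : r * x = p * x + z1 * z3 ^ 2 * (z1 - z2 + z3) := hr
  generalize hH : -(z1 * z3 ^ 2 * (z1 - z2 + z3)) = H at iA iN4 iN6
  have hrx : r * x = p * x - H := by rw [hh, ← hH]; ring
  have hla4 : φ la4 = p * x := by
    rw [hq] at e4
    linear_combination -e4 + hH + hrx + (φ la4 + r * x + 2 * r ^ 2) * h3
  rw [hq, hla4] at e6
  have hs : φ σ₁R ^ 2 = u ^ 4 := by rw [s1, i1]; ring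
  have hR2 : r ^ 2 * x ^ 2 = (p * x - H) ^ 2 := by rw [← hrx]; ring
  have hR3 : r ^ 3 * x ^ 3 = (p * x - H) ^ 3 := by rw [← hrx]; ring
  refine ⟨hq, hla4, ?_, hs, ?_, ?_, ?_⟩
  · have hxJ : x ^ 6 * J = u ^ 24 * (t ^ 7 - t ^ 8) := by
      rw [← hu]
      linear_combination u ^ 24 * hJ
    refine mul_left_cancel₀ (pow_ne_zero 3 hx0) ?_
    linear_combination x ^ 3 * e6 - 4 * x ^ 3 * p * hrx - 4 * x ^ 2 * hR2 - 4 * hR3 + iA - hxJ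
      + (-x ^ 3 * φ la6 - 4 * x * p * H ^ 2 + 4 * x ^ 2 * p ^ 2 * H - x ^ 2 * H ^ 2 + 4 * x ^ 3 * p * H
        - x ^ 3 * p ^ 3 - 3 * x ^ 4 * p ^ 2 + H ^ 3) * h3
  · rw [hs] at n4
    linear_combination x * n4 + u ^ 4 * hrx + iN4
  · rw [hs] at n6
    linear_combination x ^ 2 * n6 + u ^ 4 * hR2
      + 2 * (-z1 ^ 3 * z3 - z1 * z2 ^ 3 - z1 ^ 2 * z3 ^ 2) * x * hrx + 2 * p * x * iN4 + iN6
  · rw [s3, i3]; ring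

theorem coprime_QP {k : Type*} [Field k] (h3 : (3 : k) = 0) :
    IsCoprime (Polynomial.X ^ 7 - Polynomial.X ^ 8 : Polynomial k) ((1 + Polynomial.X) ^ 6) := by
  have e : (Polynomial.X ^ 7 - Polynomial.X ^ 8 : Polynomial k)
      = Polynomial.X ^ 7 * (1 - Polynomial.X) := by ring
  have h3' : (3 : Polynomial k) = 0 := by
    have := congrArg Polynomial.C h3
    rwa [map_ofNat, map_zero] at this
  rw [e]
  refine IsCoprime.pow_right (IsCoprime.mul_left (IsCoprime.pow_left ?_) ?_)
  · exact ⟨-1, 1, by ring⟩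
  · exact ⟨-1, -1, by linear_combination -h3'⟩

theorem degree_Q {k : Type*} [Field k] :
    (Polynomial.X ^ 7 - Polynomial.X ^ 8 : Polynomial k).degree = 8 := by
  rw [Polynomial.degree_sub_eq_right_of_degree_lt]
  · simp
  · simp only [Polynomial.degree_X_pow]
    exact_mod_cast (by norm_num : 7 < 8)

/-- The key relation, after clearing denominators. -/
theorem key_relation {F : Type*} [Field F] {x p t s n4 n6 : F} (hx0 : x ≠ 0)
    (hs : s * (1 + t) = x) (hn4 : n4 * x = s * p * x - s ^ 3 * (t + t ^ 3))
    (hn6 : n6 * x ^ 2 = s * p ^ 2 * x ^ 2 - 2 * p * x * (s ^ 3 * (t + t ^ 3))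
      + s ^ 5 * (t ^ 6 - t ^ 5 - t ^ 4)) (D : Fin 8 → F)
    (h : D 0 + D 1 * s + D 2 * s ^ 2 + D 3 * n4 + D 4 * (s * n4) + D 5 * n6 + D 6 * (s * n6)
      + D 7 * (s ^ 3 * t ^ 4) = 0) :
    D 0 * (1 + t) ^ 6 + (x * (D 1 + p * D 3 + p ^ 2 * D 5)) * (1 + t) ^ 5
      + (x ^ 2 * (D 2 + p * D 4 + p ^ 2 * D 6)) * (1 + t) ^ 4
      + (-(x ^ 2 * (D 3 + 2 * p * D 5))) * (t + t ^ 3) * (1 + t) ^ 3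
      + (-(x ^ 3 * (D 4 + 2 * p * D 6))) * (t + t ^ 3) * (1 + t) ^ 2
      + (x ^ 3 * D 5) * (t ^ 6 - t ^ 5 - t ^ 4) * (1 + t)
      + (x ^ 4 * D 6) * (t ^ 6 - t ^ 5 - t ^ 4) + (x ^ 3 * D 7) * t ^ 4 * (1 + t) ^ 3 = 0 := by
  have hs0 : s ≠ 0 := by
    rintro rfl
    simp at hs
    exact hx0 hs.symm
  have e4 : n4 * (1 + t) = s * p * (1 + t) - s ^ 2 * (t + t ^ 3) := by
    rw [← hs] at hn4
    refine mul_left_cancel₀ hs0 ?_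
    linear_combination hn4
  have e6 : n6 * (1 + t) ^ 2 = s * p ^ 2 * (1 + t) ^ 2 - 2 * p * (1 + t) * (s ^ 2 * (t + t ^ 3))
      + s ^ 3 * (t ^ 6 - t ^ 5 - t ^ 4) := by
    rw [← hs] at hn6
    refine mul_left_cancel₀ (pow_ne_zero 2 hs0) ?_
    linear_combination hn6
  clear hn4 hn6
  subst hs
  linear_combination (1 + t) ^ 6 * h - (1 + t) ^ 5 * (D 3 + s * D 4) * e4
    - (1 + t) ^ 4 * (D 5 + s * D 6) * e6

/-- the eight mixed coefficients. -/
def coefE {A : Type*} [CommRing A] (x p : A) (D : Fin 8 → A) : Fin 8 → A :=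
  ![D 0, x * (D 1 + p * D 3 + p ^ 2 * D 5), x ^ 2 * (D 2 + p * D 4 + p ^ 2 * D 6),
    -(x ^ 2 * (D 3 + 2 * p * D 5)), -(x ^ 3 * (D 4 + 2 * p * D 6)), x ^ 3 * D 5, x ^ 4 * D 6,
    x ^ 3 * D 7]

theorem map_coefE {A B : Type*} [CommRing A] [CommRing B] (f : A →+* B) (x p : A) (D : Fin 8 → A)
    (i : Fin 8) : f (coefE x p D i) = coefE (f x) (f p) (fun j => f (D j)) i := by
  have h2 : f 2 = 2 := map_ofNat f 2
  fin_cases i <;> simp [coefE, h2]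

theorem map_mixE {A B : Type*} [CommRing A] [CommRing B] (f : A →+* B) (E : Fin 8 → A)
    (i : Fin 8) : f (mixE E i) = mixE (fun j => f (E j)) i := by
  fin_cases i <;> simp [mixE]

theorem coefE_eq_zero {A : Type*} [CommRing A] [IsDomain A] {x p : A} (hx : x ≠ 0)
    {D : Fin 8 → A} (h : ∀ i, coefE x p D i = 0) : ∀ i, D i = 0 := by
  have h0 : D 0 = 0 := h 0
  have h1 : x * (D 1 + p * D 3 + p ^ 2 * D 5) = 0 := h 1
  have h2 : x ^ 2 * (D 2 + p * D 4 + p ^ 2 * D 6) = 0 := h 2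
  have h3 : -(x ^ 2 * (D 3 + 2 * p * D 5)) = 0 := h 3
  have h4 : -(x ^ 3 * (D 4 + 2 * p * D 6)) = 0 := h 4
  have h5 : x ^ 3 * D 5 = 0 := h 5
  have h6 : x ^ 4 * D 6 = 0 := h 6
  have h7 : x ^ 3 * D 7 = 0 := h 7
  have g5 : D 5 = 0 := by simpa [hx] using h5
  have g6 : D 6 = 0 := by simpa [hx] using h6
  have g7 : D 7 = 0 := by simpa [hx] using h7
  have g3 : D 3 = 0 := by simpa [hx, g5] using h3
  have g4 : D 4 = 0 := by simpa [hx, g6] using h4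
  have g1 : D 1 = 0 := by simpa [hx, g5, g3] using h1
  have g2 : D 2 = 0 := by simpa [hx, g6, g4] using h2
  intro i
  fin_cases i <;> assumption

theorem dpoly_indep {k F : Type*} [Field k] [Field F] [IsAlgClosed F] (θ : ZMod 3 →+* k)
    (ι : Polynomial k →+* F) (hι : Function.Injective ι) {x p : k} (hx : x ≠ 0)
    (c : Fin 8 → Atilde) {y : Rring} (h : ∑ i : Fin 8, lam (c i) * basis8 i = 3 * y) :
    ∀ i, dpoly θ x p (c i) = 0 := by
  have h3k : (3 : k) = 0 := by
    have : θ 3 = 0 := by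
      rw [show (3 : ZMod 3) = 0 from by decide, map_zero]
    rwa [map_ofNat] at this
  have h3p : (3 : Polynomial k) = 0 := by
    have := congrArg Polynomial.C h3k
    rwa [map_ofNat, map_zero] at this
  have h3F : (3 : F) = 0 := by
    have := congrArg ι h3p
    rwa [map_ofNat, map_zero] at this
  set t : F := ι Polynomial.X with ht
  set x' : F := ι (Polynomial.C x) with hx'
  set p' : F := ι (Polynomial.C p) with hp'
  have hx0 : x' ≠ 0 := by
    rw [hx', Ne, map_eq_zero_iff ι hι, Polynomial.C_eq_zero]
    exact hx
  have ht0 : 1 + t ≠ 0 := by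
    have : 1 + t = ι (1 + Polynomial.X) := by simp [ht]
    rw [this, Ne, map_eq_zero_iff ι hι]
    intro h0
    have := congrArg (Polynomial.eval 0) h0
    simp at this
  obtain ⟨u, hu⟩ := IsAlgClosed.exists_pow_nat_eq (x' / (1 + t)) (n := 4) (by norm_num)
  rw [eq_div_iff ht0] at hu
  obtain ⟨b, hb⟩ : ∃ b : F, b * u ^ 2 - b ^ 3 = t * u ^ 3 := by
    obtain ⟨b, hb⟩ := IsAlgClosed.exists_root
      (Polynomial.X ^ 3 + (Polynomial.C (t * u ^ 3) - Polynomial.C (u ^ 2) * Polynomial.X))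
      (by
        rw [Polynomial.degree_add_eq_left_of_degree_lt]
        · simp
        · rw [Polynomial.degree_X_pow]
          refine lt_of_le_of_lt (b := ((1 : ℕ) : WithBot ℕ)) ?_
            (by exact_mod_cast (by norm_num : 1 < 3))
          compute_degree
          exact le_rfl)
    refine ⟨b, ?_⟩
    simp [Polynomial.IsRoot] at hb
    linear_combination -hb
  set J : F := (t ^ 7 - t ^ 8) / (1 + t) ^ 6 with hJdef
  have hJ : J * (1 + t) ^ 6 = t ^ 7 - t ^ 8 := div_mul_cancel₀ _ (pow_ne_zero 6 ht0)
  set z1 : F := b * (u + 2 * b) with hz1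
  set z2 : F := (u + b) * (u + 2 * b) with hz2
  set z3 : F := -((u + b) * b) with hz3
  set r : F := p' + z1 * z3 ^ 2 * (z1 - z2 + z3) / x' with hr
  obtain ⟨φ, hφ, hφa⟩ := exists_point ((ι.comp Polynomial.C).comp θ) ![z1, z2, z3, r] (by
    simp [hz1, hz2, hz3]; ring)
  have q0 : φ (zR 0) = z1 := hφ 0
  have q1 : φ (zR 1) = z2 := hφ 1
  have q2 : φ (zR 2) = z3 := hφ 2
  have q3 : φ (zR 3) = r := hφ 3
  obtain ⟨v2, v4, v6, vs, vn4, vn6, vt⟩ := point_values (p := p') h3F φ hx0 hu hb hJ q0 q1 q2 (by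
    rw [q0, q1, q2, q3, hr]; field_simp)
  have hlam : ∀ a : Atilde, φ (lam a)
      = Polynomial.eval₂RingHom (ι.comp Polynomial.C) J (dpoly θ x p a) := by
    intro a
    have : φ.comp (lam : Atilde →+* Rring)
        = (Polynomial.eval₂RingHom (ι.comp Polynomial.C) J).comp (dpoly θ x p) := by
      apply MvPolynomial.ringHom_ext
      · intro a
        have h1 : lam (C a) = algebraMap Z3loc Rring a := by
          rw [← MvPolynomial.algebraMap_eq, AlgHom.commutes]
        simp only [RingHom.comp_apply, RingHom.coe_coe, h1, hφa, dpoly]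
        simp
      · intro i
        simp only [RingHom.comp_apply, RingHom.coe_coe, dpoly]
        fin_cases i
        · simpa [lam_X0] using v2
        · simpa [lam_X1] using v4
        · simpa [lam_X2, Polynomial.eval₂_pow] using v6
    exact DFunLike.congr_fun this a
  have hrel := congrArg φ h
  rw [map_sum, map_mul, map_ofNat, h3F, zero_mul, Fin.sum_univ_eight] at hrel
  simp only [map_mul, hlam] at hrel
  have hk := key_relation (p := p') (s := u ^ 4) (n4 := φ n4R) (n6 := φ n6R) hx0 hu
    (by rw [vn4]; ring) (by rw [vn6]; ring)
    (fun i => Polynomial.eval₂RingHom (ι.comp Polynomial.C) J (dpoly θ x p (c i))) (by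
      rw [← hrel, ← vs]
      have e4 : φ σ₁R ^ 4 = φ σ₁R ^ 2 * φ σ₁R ^ 2 := by ring
      have e7 : (φ σ₁R ^ 2) ^ 3 * t ^ 4 = φ σ₃R ^ 2 := by rw [vt, vs]; ring
      have b0 : φ (basis8 0) = 1 := map_one φ
      have b1 : φ (basis8 1) = φ σ₁R ^ 2 := map_pow φ _ _
      have b2 : φ (basis8 2) = φ σ₁R ^ 4 := map_pow φ _ _
      have b3 : φ (basis8 3) = φ n4R := rfl
      have b4 : φ (basis8 4) = φ σ₁R ^ 2 * φ n4R := by rw [← map_pow, ← map_mul]; rfl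
      have b5 : φ (basis8 5) = φ n6R := rfl
      have b6 : φ (basis8 6) = φ σ₁R ^ 2 * φ n6R := by rw [← map_pow, ← map_mul]; rfl
      have b7 : φ (basis8 7) = φ σ₃R ^ 2 := map_pow φ _ _
      rw [e7, b0, b1, b2, b3, b4, b5, b6, b7, e4]
      ring)
  have hm := mix h3F (coefE x' p'
    (fun i => Polynomial.eval₂RingHom (ι.comp Polynomial.C) J (dpoly θ x p (c i)))) t
  have hsum := hm.symm.trans hk
  have hzero := eval_indep ι hι (coprime_QP h3k) degree_Q (J := J) (by simpa [ht] using hJ)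
    (mixE (coefE (Polynomial.C x) (Polynomial.C p) fun i => dpoly θ x p (c i))) (by
      have hC : ∀ a : k, Polynomial.eval₂RingHom (ι.comp Polynomial.C) J (Polynomial.C a)
        = ι (Polynomial.C a) := by
        intro a; simp
      have hmm : ∀ i, Polynomial.eval₂ (ι.comp Polynomial.C) J
          (mixE (coefE (Polynomial.C x) (Polynomial.C p) fun i => dpoly θ x p (c i)) i)
          = mixE (coefE x' p' (fun i => Polynomial.eval₂RingHom (ι.comp Polynomial.C) J
            (dpoly θ x p (c i)))) i := by
        intro i
        have := map_mixE (Polynomial.eval₂RingHom (ι.comp Polynomial.C) J)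
          (coefE (Polynomial.C x) (Polynomial.C p) fun i => dpoly θ x p (c i)) i
        rw [Polynomial.coe_eval₂RingHom] at this
        rw [this]
        congr 1
        funext j
        rw [← Polynomial.coe_eval₂RingHom, map_coefE, hC, hC]
      rw [Fin.sum_univ_eight]
      simp only [hmm]
      exact hsum)
  refine coefE_eq_zero (x := Polynomial.C x) (p := Polynomial.C p) (by simpa using hx) ?_
  exact unmix h3p (hzero 0) (hzero 1) (hzero 2) (hzero 3) (hzero 4) (hzero 5) (hzero 6) (hzero 7)

/-- The polynomial ring over the residue field. -/
abbrev BB : Type := MvPolynomial (Fin 3) (ZMod 3)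

/-- Its field of fractions. -/
abbrev KK : Type := FractionRing BB

theorem three_dvd_coeffs (c : Fin 8 → Atilde) {y : Rring}
    (h : ∑ i : Fin 8, lam (c i) * basis8 i = 3 * y) : ∀ i, (3 : Atilde) ∣ c i := by
  intro i
  obtain ⟨ι, hι⟩ : ∃ ι : Polynomial KK →+* AlgebraicClosure (FractionRing (Polynomial KK)),
      Function.Injective ι :=
    ⟨(algebraMap (FractionRing (Polynomial KK)) _).comp (algebraMap _ _),
      (algebraMap (FractionRing (Polynomial KK)) _).injective.comp
        (IsFractionRing.injective (Polynomial KK) _)⟩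
  have hk : Function.Injective (algebraMap BB KK) := IsFractionRing.injective BB KK
  obtain ⟨x, hxd⟩ : ∃ x : KK, algebraMap BB KK (X 0) = x := ⟨_, rfl⟩
  obtain ⟨z, hzd⟩ : ∃ x : KK, algebraMap BB KK (X 1) = x := ⟨_, rfl⟩
  obtain ⟨w, hwd⟩ : ∃ x : KK, algebraMap BB KK (X 2) = x := ⟨_, rfl⟩
  have hx : x ≠ 0 := by
    intro h0
    exact X_ne_zero (R := ZMod 3) (0 : Fin 3) (hk (by rw [map_zero, hxd, h0]))
  have hd := dpoly_indep ((algebraMap BB KK).comp C) ι hι (p := z / x) hx c h i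
  obtain ⟨p, hp⟩ : ∃ p : KK, z / x = p := ⟨_, rfl⟩
  have hp' : p * x = z := by rw [← hp]; exact div_mul_cancel₀ _ hx
  rw [hp] at hd
  apply three_dvd_of_map_red
  apply hk
  rw [map_zero]
  have h2 : (algebraMap BB KK).comp (MvPolynomial.map red) =
      (Polynomial.evalRingHom ((w - (x * p ^ 2 - p ^ 3)) / x ^ 3)).comp
        (dpoly ((algebraMap BB KK).comp C) x p) := by
    apply MvPolynomial.ringHom_ext
    · intro a
      simp [dpoly]
    · intro j
      rw [RingHom.comp_apply, MvPolynomial.map_X, RingHom.comp_apply, dpoly,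
        MvPolynomial.coe_eval₂Hom, MvPolynomial.eval₂_X, Polynomial.coe_evalRingHom]
      fin_cases j
      · change algebraMap BB KK (X 0) = Polynomial.eval _ (Polynomial.C x)
        rw [hxd, Polynomial.eval_C]
      · change algebraMap BB KK (X 1) = Polynomial.eval _ (Polynomial.C (p * x))
        rw [hzd, hp', Polynomial.eval_C]
      · change algebraMap BB KK (X 2) = Polynomial.eval _ (Polynomial.C (x ^ 3) * Polynomial.X
          + Polynomial.C (x * p ^ 2 - p ^ 3))
        rw [hwd, Polynomial.eval_add, Polynomial.eval_mul, Polynomial.eval_C, Polynomial.eval_C,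
          Polynomial.eval_X, mul_div_cancel₀ _ (pow_ne_zero 3 hx)]
        ring
  have h3 := DFunLike.congr_fun h2 (c i)
  simp only [RingHom.comp_apply] at h3
  rw [h3, hd, map_zero]

theorem lam_sum_three (c d : Fin 8 → Atilde) (h : ∀ i, c i = 3 * d i) :
    ∑ i : Fin 8, lam (c i) * basis8 i = 3 * ∑ i : Fin 8, lam (d i) * basis8 i := by
  rw [Finset.mul_sum]
  refine Finset.sum_congr rfl fun i _ => ?_
  rw [h i, map_mul, map_ofNat, mul_assoc]

theorem InN.inM {x : Rring} (hx : InN x) : InM x := by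
  obtain ⟨n, hn, hx⟩ := hx
  refine sat_induction (p := InM) ?_ ?_ hn hx
  · rintro x ⟨c, hc⟩
    choose d hd using three_dvd_coeffs c hc.symm
    refine ⟨d, ?_⟩
    rw [lam_sum_three c d hd] at hc
    have : x - ∑ i : Fin 8, lam (d i) * basis8 i = 0 := by
      apply three_torsion
      rw [mul_sub, hc, sub_self]
    exact sub_eq_zero.1 this
  · intro a x hx
    have := hx.lam_mul (C a)
    rwa [← MvPolynomial.algebraMap_eq, AlgHom.commutes] at this

theorem three_not_isUnit : ¬ IsUnit (3 : Atilde) := by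
  intro h
  have := h.map (MvPolynomial.map (σ := Fin 3) red)
  rw [map_ofNat, show (3 : MvPolynomial (Fin 3) (ZMod 3)) = C 3 from (map_ofNat C 3).symm,
    show (3 : ZMod 3) = 0 from by decide, C_0] at this
  exact not_isUnit_zero this

theorem three_ne_zero_A : (3 : Atilde) ≠ 0 := by
  have : ((3 : ℕ) : Atilde) ≠ 0 := Nat.cast_ne_zero.2 (by norm_num)
  exact_mod_cast this

theorem coeffs_zero (c : Fin 8 → Atilde) (h : ∑ i : Fin 8, lam (c i) * basis8 i = 0) :
    ∀ i, c i = 0 := by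
  have hp : ∀ n : ℕ, ∀ c : Fin 8 → Atilde, ∑ i : Fin 8, lam (c i) * basis8 i = 0 →
      ∀ i, (3 : Atilde) ^ n ∣ c i := by
    intro n
    induction n with
    | zero => intro c _ i; simp
    | succ n ih =>
      intro c hc i
      choose d hd using three_dvd_coeffs c (y := 0) (by rw [hc, mul_zero])
      rw [lam_sum_three c d hd] at hc
      rw [hd i, pow_succ']
      exact mul_dvd_mul_left _ (ih d (three_torsion hc) i)
  intro i
  by_contra hne
  obtain ⟨n, hn⟩ := FiniteMultiplicity.of_not_isUnit three_not_isUnit hne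
  exact hn (hp _ c h i)

/-- Let `τ` be the `ℤ_(3)`-algebra automorphism of `R` with `τ(z₁) = −z₃`, `τ(z₂) = −z₁`,
`τ(z₃) = −z₂`, `τ(r) = r + z₂z₃`.  The fixed subring `S = {x ∈ R : τ(x) = x}` is a free
`Ã`-module of rank `8` (with `Ã` acting through `λ`) with basis
`1, σ₁², σ₁⁴, n₄, σ₁²n₄, n₆, σ₁²n₆, σ₃²`: an element of `R` is `τ`-fixed iff it is an
`Ã`-linear combination of these eight elements, and such a representation is unique. -/
theorem fixed_subring_free_of_rank_8 (τ : Rring ≃ₐ[Z3loc] Rring)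
    (h1 : τ (zR 0) = -zR 2) (h2 : τ (zR 1) = -zR 0) (h3 : τ (zR 2) = -zR 1)
    (h4 : τ (zR 3) = zR 3 + zR 1 * zR 2) :
    (∀ x : Rring, τ x = x ↔
      ∃ c : Fin 8 → Atilde, x = ∑ i : Fin 8, lam (c i) * basis8 i) ∧
    (∀ c c' : Fin 8 → Atilde,
      ∑ i : Fin 8, lam (c i) * basis8 i = ∑ i : Fin 8, lam (c' i) * basis8 i → c = c') := by
  have h : IsTau τ := ⟨h1, h2, h3, h4⟩
  refine ⟨fun x => ⟨fun hx => (inN_of_fixed h hx).inM, fun hx => h.of_inM hx⟩, ?_⟩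
  intro c c' hcc
  have hz := coeffs_zero (fun i => c i - c' i) (by
    rw [← sub_eq_zero.2 hcc, ← Finset.sum_sub_distrib]
    refine Finset.sum_congr rfl fun i _ => ?_
    rw [map_sub, sub_mul])
  funext i
  exact sub_eq_zero.1 (hz i)
end

section
/- Let Ã, R, λ, τ, n₄, n₆, σ₁, σ₃ be as given, let S = {x ∈ R : τ(x) = x}, and let W = Ã[r]/(ā₆ + ā₄r + ā₂r² + r³), a free Ã-module with basis the classes of 1, r, r². Define the Ã-linear map Θ: Ã ⊕ W ⊕ W ⊕ Ã → R by Θ(a, c₀+c₁r+c₂r², d₀+d₁r+d₂r², b) = λ(a) + λ(c₀)σ₁² + λ(c₁)n₄ + λ(c₂)n₆ + λ(d₀)σ₁⁴ + λ(d₁)σ₁²n₄ + λ(d₂)σ₁²n₆ + λ(b)σ₃², for a, b, c_i, d_i ∈ Ã. Then: (i) Θ is an injective Ã-module homomorphism whose image is exactly S. (ii) Θ intertwines the comultiplications: letting Φ: R → R[s] be the ring homomorphism fixing z₁, z₂, z₃ and sending r ↦ r+s, one has Φ(σ₁²) = σ₁², Φ(σ₁⁴) = σ₁⁴, Φ(σ₃²)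 = σ₃², Φ(n₄) = n₄ + s·σ₁², Φ(n₆) = n₆ + 2s·n₄ + s²·σ₁², Φ(σ₁²n₄) = σ₁²n₄ + s·σ₁⁴, and Φ(σ₁²n₆) = σ₁²n₆ + 2s·σ₁²n₄ + s²·σ₁⁴ in R[s] — i.e., on each W-summand Φ∘Θ realizes the substitution pattern 1 ↦ 1, r ↦ r+s, r² ↦ (r+s)² in the basis 1, r, r², and Φ∘Θ is the identity pattern on each Ã-summand. -/
open MvPolynomial

/-- The `Ã`-linear map `Θ : Ã ⊕ W ⊕ W ⊕ Ã → R` (with `W = Ã[r]/(ā₆+ā₄r+ā₂r²+r³)` free on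
`1, r, r²`, given here in coordinates), sending `(a, (c₀,c₁,c₂), (d₀,d₁,d₂), b)` to
`λ(a) + λ(c₀)σ₁² + λ(c₁)n₄ + λ(c₂)n₆ + λ(d₀)σ₁⁴ + λ(d₁)σ₁²n₄ + λ(d₂)σ₁²n₆ + λ(b)σ₃²`. -/
noncomputable def Theta (v : Atilde × (Fin 3 → Atilde) × (Fin 3 → Atilde) × Atilde) : Rring :=
  lam v.1 + lam (v.2.1 0) * σ₁R ^ 2 + lam (v.2.1 1) * n4R + lam (v.2.1 2) * n6R
    + lam (v.2.2.1 0) * σ₁R ^ 4 + lam (v.2.2.1 1) * (σ₁R ^ 2 * n4R)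
    + lam (v.2.2.1 2) * (σ₁R ^ 2 * n6R) + lam v.2.2.2 * σ₃R ^ 2


namespace Prf

instance : IsDomain Z3loc :=
  IsLocalization.isDomain_localization (M := (Ideal.span {(3 : ℤ)}).primeCompl)
    (Ideal.primeCompl_le_nonZeroDivisors _)

noncomputable instance : Algebra ℤ Z3loc :=
  inferInstanceAs (Algebra ℤ (Localization.AtPrime (Ideal.span {(3 : ℤ)})))

instance isLoc : IsLocalization.AtPrime Z3loc (Ideal.span {(3 : ℤ)}) :=
  inferInstanceAs (IsLocalization.AtPrime (Localization.AtPrime (Ideal.span {(3 : ℤ)}))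
    (Ideal.span {(3 : ℤ)}))

instance : IsNoetherianRing Z3loc :=
  IsLocalization.isNoetherianRing (Ideal.span {(3 : ℤ)}).primeCompl Z3loc inferInstance

theorem algMap_eq (n : ℤ) : algebraMap ℤ Z3loc n = (n : Z3loc) := by
  simp

instance : CharZero Z3loc := by
  have hinj : Function.Injective (algebraMap ℤ Z3loc) :=
    IsLocalization.injective (M := (Ideal.span {(3 : ℤ)}).primeCompl) Z3loc
      (Ideal.primeCompl_le_nonZeroDivisors _)
  refine ⟨fun a b h => ?_⟩
  have : algebraMap ℤ Z3loc a = algebraMap ℤ Z3loc b := by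
    simpa [algMap_eq] using h
  exact_mod_cast hinj this

theorem isUnit_of_not_dvd (n : ℤ) (h : ¬ (3 : ℤ) ∣ n) : IsUnit (n : Z3loc) := by
  have := IsLocalization.map_units (M := (Ideal.span {(3 : ℤ)}).primeCompl) Z3loc
    ⟨n, fun hn => h (Ideal.mem_span_singleton.mp hn)⟩
  simpa [algMap_eq] using this

theorem pi_units (y : (Ideal.span {(3 : ℤ)}).primeCompl) :
    IsUnit ((Int.castRingHom (ZMod 3)) y) := by
  obtain ⟨y, hy⟩ := y
  have : ((y : ℤ) : ZMod 3) ≠ 0 := fun h =>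
    hy (Ideal.mem_span_singleton.mpr ((ZMod.intCast_zmod_eq_zero_iff_dvd y 3).mp h))
  exact isUnit_iff_ne_zero.mpr this

/-- reduction mod 3 -/
noncomputable def red3 : Z3loc →+* ZMod 3 :=
  IsLocalization.lift (M := (Ideal.span {(3 : ℤ)}).primeCompl) (S := Z3loc) pi_units

theorem red3_ker (x : Z3loc) (h : red3 x = 0) : (3 : Z3loc) ∣ x := by
  obtain ⟨⟨n, s⟩, hs⟩ := IsLocalization.surj (Ideal.span {(3 : ℤ)}).primeCompl x
  simp only [algMap_eq] at hs
  have h2 : red3 (n : Z3loc) = 0 := by rw [← hs, map_mul, h, zero_mul]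
  rw [map_intCast] at h2
  obtain ⟨m, rfl⟩ := (ZMod.intCast_zmod_eq_zero_iff_dvd n 3).mp h2
  have hu : IsUnit ((s : ℤ) : Z3loc) := isUnit_of_not_dvd _ fun hd =>
    s.2 (Ideal.mem_span_singleton.mpr hd)
  rw [← hu.dvd_mul_right, hs]
  push_cast
  exact dvd_mul_right _ _

theorem red3_surj : Function.Surjective red3 := fun x => by
  obtain ⟨n, rfl⟩ := ZMod.intCast_surjective x
  exact ⟨n, map_intCast _ _⟩

theorem map_red3_ker {σ : Type*} (f : MvPolynomial σ Z3loc) (h : map red3 f = 0) :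
    ∃ g, f = 3 * g := by
  have : (C (3 : Z3loc)) ∣ f := by
    rw [C_dvd_iff_dvd_coeff]
    intro i
    apply red3_ker
    rw [← coeff_map, h, coeff_zero]
  obtain ⟨g, hg⟩ := this
  exact ⟨g, by rw [hg, show (C (3 : Z3loc) : MvPolynomial σ Z3loc) = 3 from map_ofNat C 3]⟩

/-- homs out of R -/
noncomputable def Rlift {B : Type*} [CommRing B] (f : Z3loc →+* B) (u : Fin 4 → B)
    (h : u 0 * u 1 + u 1 * u 2 + u 2 * u 0 = 0) : Rring →+* B :=
  Ideal.Quotient.lift _ (eval₂Hom f u) (by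
    intro a ha
    obtain ⟨c, rfl⟩ := Ideal.mem_span_singleton.mp ha
    simp [h])

@[simp] theorem Rlift_z {B : Type*} [CommRing B] (f : Z3loc →+* B) (u : Fin 4 → B)
    (h : u 0 * u 1 + u 1 * u 2 + u 2 * u 0 = 0) (i : Fin 4) : Rlift f u h (zR i) = u i := by
  simp [Rlift, zR]

theorem algMapR (c : Z3loc) : algebraMap Z3loc Rring c = Ideal.Quotient.mk _ (C c) := rfl

@[simp] theorem Rlift_C {B : Type*} [CommRing B] (f : Z3loc →+* B) (u : Fin 4 → B)
    (h : u 0 * u 1 + u 1 * u 2 + u 2 * u 0 = 0) (c : Z3loc) :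
    Rlift f u h (algebraMap Z3loc Rring c) = f c := by
  simp [Rlift, algMapR]

theorem hrel : zR 0 * zR 1 + zR 1 * zR 2 + zR 2 * zR 0 = 0 := by
  simp only [zR, ← map_mul, ← map_add]
  exact Ideal.Quotient.eq_zero_iff_mem.mpr (Ideal.subset_span rfl)

theorem R_induction {p : Rring → Prop} (hC : ∀ c : Z3loc, p (algebraMap _ _ c))
    (hadd : ∀ x y, p x → p y → p (x + y)) (hmul : ∀ x i, p x → p (x * zR i)) (x : Rring) : p x := by
  obtain ⟨y, rfl⟩ := Ideal.Quotient.mk_surjective x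
  induction y using MvPolynomial.induction_on with
  | C a => exact hC a
  | add f g hf hg => rw [map_add]; exact hadd _ _ hf hg
  | mul_X f i hf => rw [map_mul]; exact hmul _ i hf

/-- normal form map -/
noncomputable def Fm : MvPolynomial (Fin 3) Z3loc →ₐ[Z3loc] Rring :=
  aeval ![-(zR 0 + zR 1), -(zR 0 + zR 2), zR 3]

theorem normal_form (x : Rring) : ∃ f g, x = Fm f + zR 0 * Fm g := by
  have e0 : Fm (X 0) = -(zR 0 + zR 1) := by simp [Fm]
  have e1 : Fm (X 1) = -(zR 0 + zR 2) := by simp [Fm]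
  have e2 : Fm (X 2) = zR 3 := by simp [Fm]
  induction x using R_induction with
  | hC c => exact ⟨C c, 0, by simp [Fm]⟩
  | hadd x y hx hy =>
    obtain ⟨f, g, rfl⟩ := hx
    obtain ⟨f', g', rfl⟩ := hy
    exact ⟨f + f', g + g', by simp only [map_add]; ring⟩
  | hmul x i hx =>
    obtain ⟨f, g, rfl⟩ := hx
    have hi : i = 0 ∨ i = 1 ∨ i = 2 ∨ i = 3 := by omega
    rcases hi with rfl | rfl | rfl | rfl
    · refine ⟨X 0 * X 1 * g, f, ?_⟩
      simp only [map_mul, e0, e1]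
      linear_combination (-Fm g) * hrel
    · refine ⟨-X 0 * f - X 0 * X 1 * g, -X 0 * g - f, ?_⟩
      simp only [map_mul, map_sub, map_neg, e0, e1]
      linear_combination (Fm g) * hrel
    · refine ⟨-X 1 * f - X 0 * X 1 * g, -X 1 * g - f, ?_⟩
      simp only [map_mul, map_sub, map_neg, e0, e1]
      linear_combination (Fm g) * hrel
    · refine ⟨X 2 * f, X 2 * g, ?_⟩
      simp only [map_mul, e2]
      ring

/-- the embedding into a polynomial ring (with r ↦ r², for convenience) -/
noncomputable def iot {B : Type*} [CommRing B] (φ : Z3loc →+* B) :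
    Rring →+* MvPolynomial (Fin 3) B :=
  Rlift (C.comp φ) ![X 0 * X 1, -X 0 ^ 2 - X 0 * X 1, - X 0 * X 1 - X 1 ^ 2, X 2 ^ 2] (by
    simp; ring)

theorem iot_Fm {B : Type*} [CommRing B] (φ : Z3loc →+* B) (f) :
    iot φ (Fm f) = expand 2 (map φ f) := by
  induction f using MvPolynomial.induction_on with
  | C a => simp [Fm, iot]
  | add f g hf hg => simp only [map_add, hf, hg]
  | mul_X f i hf =>
    simp only [map_mul, hf]
    congr 1
    fin_cases i <;> simp [Fm, iot]

theorem parity {B : Type*} [CommRing B] [IsDomain B] (h2 : (2 : B) ≠ 0)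
    (f g : MvPolynomial (Fin 3) B) (h : expand 2 f + X 0 * X 1 * expand 2 g = 0) :
    f = 0 ∧ g = 0 := by
  let ν : MvPolynomial (Fin 3) B →ₐ[B] MvPolynomial (Fin 3) B := aeval ![-X 0, X 1, X 2]
  have hν : ∀ p : MvPolynomial (Fin 3) B, ν (expand 2 p) = expand 2 p := by
    intro p
    induction p using MvPolynomial.induction_on with
    | C a => simp [ν]
    | add f g hf hg => simp only [map_add, hf, hg]
    | mul_X f i hf =>
      simp only [map_mul, hf]
      congr 1
      fin_cases i <;> simp [ν]
  have h' := congrArg ν h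
  simp only [map_add, map_mul, hν, map_zero] at h'
  have a0 : ν (X 0) = - X 0 := by simp [ν]
  have a1 : ν (X 1) = X 1 := by simp [ν]
  rw [a0, a1] at h'
  have hh : (2 : MvPolynomial (Fin 3) B) ≠ 0 := by
    have : (C (2 : B) : MvPolynomial (Fin 3) B) ≠ 0 := by simpa using h2
    rwa [show (C (2 : B) : MvPolynomial (Fin 3) B) = 2 from map_ofNat C 2] at this
  have k1 : 2 * expand 2 f = 0 := by linear_combination h + h'
  have k2 := (mul_eq_zero.mp k1).resolve_left hh
  rw [k2, zero_add] at h
  have k3 := (mul_eq_zero.mp h).resolve_left (mul_ne_zero (X_ne_zero _) (X_ne_zero _))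
  exact ⟨(expand_eq_zero (by norm_num)).mp k2, (expand_eq_zero (by norm_num)).mp k3⟩

theorem iot_injective : Function.Injective (iot (RingHom.id Z3loc)) := by
  rw [injective_iff_map_eq_zero]
  intro x hx
  obtain ⟨f, g, rfl⟩ := normal_form x
  rw [map_add, map_mul, iot_Fm, iot_Fm] at hx
  simp only [map_id] at hx
  obtain ⟨rfl, rfl⟩ := parity (two_ne_zero) f g (by simpa [iot] using hx)
  simp

theorem iot3_ker (x : Rring) (hx : iot red3 x = 0) : ∃ y, x = 3 * y := by
  obtain ⟨f, g, rfl⟩ := normal_form x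
  rw [map_add, map_mul, iot_Fm, iot_Fm] at hx
  obtain ⟨hf, hg⟩ := parity (by decide) (map red3 f) (map red3 g) (by simpa [iot] using hx)
  obtain ⟨f', rfl⟩ := map_red3_ker f hf
  obtain ⟨g', rfl⟩ := map_red3_ker g hg
  exact ⟨Fm f' + zR 0 * Fm g', by simp only [map_mul, map_ofNat]; ring⟩

instance : IsDomain Rring := iot_injective.isDomain (iot (RingHom.id Z3loc))

instance : CharZero Rring := by
  refine ⟨fun a b h => ?_⟩
  have := congrArg (iot (RingHom.id Z3loc)) h
  simpa using this

theorem four_inv : (4 : Rring) * Ring.inverse 4 = 1 := by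
  apply Ring.mul_inverse_cancel
  have := (isUnit_of_not_dvd 4 (by decide)).map (algebraMap Z3loc Rring)
  rw [map_intCast] at this
  exact_mod_cast this

theorem two_inv : (2 : Rring) * Ring.inverse 2 = 1 := by
  apply Ring.mul_inverse_cancel
  have := (isUnit_of_not_dvd 2 (by decide)).map (algebraMap Z3loc Rring)
  rw [map_intCast] at this
  exact_mod_cast this

theorem ea2 : 4 * la2 = (zR 0 - zR 1 + zR 2) ^ 2 - 4 * zR 1 * zR 2 - 12 * zR 3 := by
  unfold la2
  linear_combination (zR 0 - zR 1 + zR 2) ^ 2 * four_inv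

theorem ea4 : 2 * la4 = (zR 0 * zR 2 ^ 2 * (zR 0 - zR 1 + zR 2)) - zR 3 * (4 * la2)
    - 6 * zR 3 ^ 2 := by
  unfold la4
  linear_combination (zR 0 * zR 2 ^ 2 * (zR 0 - zR 1 + zR 2)) * two_inv

theorem ea6 : 4 * la6 = (zR 0 ^ 2 * zR 2 ^ 4) - 2 * zR 3 * (2 * la4) - zR 3 ^ 2 * (4 * la2)
    - 4 * zR 3 ^ 3 := by
  unfold la6
  linear_combination (zR 0 ^ 2 * zR 2 ^ 4) * four_inv

end Prf


namespace Polynomial.PrfAux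
open Prf

section deg
variable {B : Type*} [CommRing B] [IsDomain B]

theorem two_case {m : ℕ} (f g : B[X]) (hf : f ≠ 0) (hg : g ≠ 0)
    (h : ¬ f.natDegree ≡ g.natDegree [MOD m]) :
    f + g ≠ 0 ∧ ((f + g).natDegree = f.natDegree ∨ (f + g).natDegree = g.natDegree) := by
  have hne : f.natDegree ≠ g.natDegree := fun e => h (by rw [e])
  refine ⟨fun h0 => hne ?_, ?_⟩
  · rw [eq_neg_of_add_eq_zero_left h0, natDegree_neg]
  · rcases lt_or_gt_of_ne hne with h1 | h1
    · right; exact natDegree_add_eq_right_of_natDegree_lt h1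
    · left; exact natDegree_add_eq_left_of_natDegree_lt h1

theorem three_case (f0 f1 f2 : B[X]) (h : f0 + f1 + f2 = 0)
    (h0 : f0 ≠ 0 → f0.natDegree % 3 = 0) (h1 : f1 ≠ 0 → f1.natDegree % 3 = 1)
    (h2 : f2 ≠ 0 → f2.natDegree % 3 = 2) : f0 = 0 ∧ f1 = 0 ∧ f2 = 0 := by
  by_cases z0 : f0 = 0
  · by_cases z1 : f1 = 0
    · subst z0 z1; simpa using h
    · by_cases z2 : f2 = 0
      · subst z0 z2; simpa using h
      · subst z0
        have := (two_case (m := 3) f1 f2 z1 z2 (by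
          have := h1 z1; have := h2 z2; unfold Nat.ModEq; omega)).1
        simp only [zero_add] at h
        exact absurd h this
  · by_cases z1 : f1 = 0
    · by_cases z2 : f2 = 0
      · subst z1 z2; simpa using h
      · subst z1
        have := (two_case (m := 3) f0 f2 z0 z2 (by
          have := h0 z0; have := h2 z2; unfold Nat.ModEq; omega)).1
        simp only [add_zero] at h
        exact absurd h this
    · have := two_case (m := 3) f0 f1 z0 z1 (by
          have := h0 z0; have := h1 z1; unfold Nat.ModEq; omega)
      by_cases z2 : f2 = 0
      · subst z2
        simp only [add_zero] at h
        exact absurd h this.1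
      · have := (two_case (m := 3) (f0 + f1) f2 this.1 z2 (by
          have := h0 z0; have := h1 z1; have := h2 z2; unfold Nat.ModEq; omega)).1
        exact absurd h this

theorem comp_indep (ζ : B[X]) (hζ : ζ.natDegree = 3) (p0 p1 p2 : B[X])
    (h : p0.comp ζ + X * p1.comp ζ + X ^ 2 * p2.comp ζ = 0) : p0 = 0 ∧ p1 = 0 ∧ p2 = 0 := by
  have hz : ∀ p : B[X], p.comp ζ = 0 → p = 0 := by
    intro p hp
    rcases comp_eq_zero_iff.mp hp with h | ⟨_, h⟩
    · exact h
    · rw [h] at hζ; simp at hζ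
  obtain ⟨a, b, c⟩ := three_case _ _ _ h
    (by intro _; rw [natDegree_comp, hζ]; omega)
    (by intro h; rw [natDegree_mul X_ne_zero (right_ne_zero_of_mul h), natDegree_comp, hζ,
          natDegree_X]; omega)
    (by intro h; rw [natDegree_mul (pow_ne_zero _ X_ne_zero) (right_ne_zero_of_mul h),
          natDegree_comp, hζ, natDegree_X_pow]; omega)
  exact ⟨hz _ a, hz _ ((mul_eq_zero.mp b).resolve_left X_ne_zero),
    hz _ ((mul_eq_zero.mp c).resolve_left (pow_ne_zero _ X_ne_zero))⟩

end deg

abbrev K3 : Type := AlgebraicClosure (ZMod 3)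

noncomputable def phi (β : K3) : (ZMod 3)[X] →+* K3[X] :=
  (compRingHom (C β * X ^ 4)).comp (mapRingHom (algebraMap (ZMod 3) K3))

theorem phi_indep (β : K3) (hβ : β ≠ 0) (a b : ℕ) (hab : ¬ a ≡ b [MOD 4]) (f g : (ZMod 3)[X])
    (h : X ^ a * phi β f + X ^ b * phi β g = 0) : f = 0 ∧ g = 0 := by
  have hd : (C β * X ^ 4 : K3[X]).natDegree = 4 := natDegree_C_mul_X_pow 4 β hβ
  have hdeg : ∀ f, (phi β f).natDegree = 4 * f.natDegree := by
    intro f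
    simp only [phi, RingHom.comp_apply, coe_compRingHom_apply, coe_mapRingHom]
    rw [natDegree_comp, hd, natDegree_map, mul_comm]
  have hz : ∀ f, phi β f = 0 → f = 0 := by
    intro f hf
    simp only [phi, RingHom.comp_apply, coe_compRingHom_apply, coe_mapRingHom] at hf
    rcases comp_eq_zero_iff.mp hf with h | ⟨_, h⟩
    · exact (Polynomial.map_eq_zero _).mp h
    · rw [h] at hd; simp at hd
  have hX : ∀ n, (X ^ n : K3[X]) ≠ 0 := fun n => pow_ne_zero _ X_ne_zero
  by_cases h1 : f = 0
  · subst h1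
    refine ⟨rfl, hz _ ?_⟩
    simpa [X_ne_zero] using h
  by_cases h2 : g = 0
  · subst h2
    refine ⟨hz _ ?_, rfl⟩
    simpa [X_ne_zero] using h
  have h1' : phi β f ≠ 0 := fun h => h1 (hz _ h)
  have h2' : phi β g ≠ 0 := fun h => h2 (hz _ h)
  refine absurd h (two_case (m := 4) _ _ (mul_ne_zero (hX _) h1') (mul_ne_zero (hX _) h2') ?_).1
  rw [natDegree_mul (hX _) h1', natDegree_mul (hX _) h2', hdeg, hdeg, natDegree_X_pow,
    natDegree_X_pow]
  unfold Nat.ModEq at *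
  omega

theorem phi_indep' (β : K3) (hβ : β ≠ 0) (a b : ℕ) (hab : ¬ a ≡ b [MOD 4]) (f g : (ZMod 3)[X][X])
    (h : C (X ^ a) * f.map (phi β) + C (X ^ b) * g.map (phi β) = 0) : f = 0 ∧ g = 0 := by
  have key : ∀ n, f.coeff n = 0 ∧ g.coeff n = 0 := by
    intro n
    apply phi_indep β hβ a b hab
    have := congrArg (fun p => p.coeff n) h
    simpa only [coeff_add, coeff_C_mul, coeff_map, coeff_zero] using this
  exact ⟨Polynomial.ext fun n => by rw [(key n).1, coeff_zero],
    Polynomial.ext fun n => by rw [(key n).2, coeff_zero]⟩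

end Polynomial.PrfAux

namespace Prf

noncomputable def ev0 : Atilde →+* Polynomial (Polynomial (ZMod 3)) :=
  eval₂Hom ((Polynomial.C.comp Polynomial.C).comp red3) ![0, Polynomial.C Polynomial.X, Polynomial.X]

theorem ev0_ker (w : Atilde) (h : ev0 w = 0) : ∃ u w' : Atilde, w = 3 * u + X 0 * w' := by
  let back : Polynomial (Polynomial (ZMod 3)) →+* MvPolynomial (Fin 3) (ZMod 3) :=
    Polynomial.eval₂RingHom (Polynomial.eval₂RingHom C (X 1)) (X 2)
  have hb : ∀ f : Atilde, (X 0) ∣ map red3 f - back (ev0 f) := by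
    intro f
    induction f using MvPolynomial.induction_on with
    | C a => simp [back, ev0]
    | add f g hf hg =>
      simp only [map_add]
      convert dvd_add hf hg using 1
      ring
    | mul_X f i hf =>
      simp only [map_mul]
      have hi : i = 0 ∨ i = 1 ∨ i = 2 := by omega
      rcases hi with rfl | rfl | rfl
      · simp [ev0]
      · have e : back (ev0 (X 1)) = X 1 := by simp [back, ev0]
        rw [e, map_X, ← sub_mul]
        exact hf.mul_right _
      · have e : back (ev0 (X 2)) = X 2 := by simp [back, ev0]
        rw [e, map_X, ← sub_mul]
        exact hf.mul_right _
  obtain ⟨q, hq⟩ := hb w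
  rw [h, map_zero, sub_zero] at hq
  obtain ⟨w', rfl⟩ := MvPolynomial.map_surjective _ red3_surj q
  obtain ⟨u, hu⟩ := map_red3_ker (w - X 0 * w') (by simp [hq])
  exact ⟨u, w', by linear_combination hu⟩

end Prf

namespace Polynomial.PrfAux
open Prf

theorem h3K : (3 : K3) = 0 := by
  have := congrArg (algebraMap (ZMod 3) K3) (show (3 : ZMod 3) = 0 by decide)
  rwa [map_ofNat, map_zero] at this

theorem h3T : (3 : K3[X][X]) = 0 := by
  have := congrArg (fun x : K3 => (C (C x) : K3[X][X])) h3K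
  simp only [map_zero] at this
  rwa [map_ofNat C, map_ofNat C] at this

noncomputable def psi (u0 u1 u2 : K3) (h : u0 * u1 + u1 * u2 + u2 * u0 = 0) : Rring →+* K3[X][X] :=
  Rlift (((C.comp C).comp (algebraMap (ZMod 3) K3)).comp red3)
    ![C (C u0 * X), C (C u1 * X), C (C u2 * X), X] (by
    simp only [Matrix.cons_val]
    have := congrArg (fun x : K3 => (C (C x * X ^ 2) : K3[X][X])) h
    simp only [C_add, C_mul, C_pow, C_0, add_mul, zero_mul] at this ⊢
    linear_combination this)

noncomputable def zet (c β : K3) : K3[X][X] := C (C c * X ^ 6) - X * C (C β * X ^ 4) - X ^ 3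

theorem zet_deg (c β : K3) : (zet c β).natDegree = 3 := by
  unfold zet
  compute_degree!

section
variable (u0 u1 u2 : K3) (h : u0 * u1 + u1 * u2 + u2 * u0 = 0)

theorem psi0 : psi u0 u1 u2 h (zR 0) = C (C u0 * X) := by simp [psi]
theorem psi1 : psi u0 u1 u2 h (zR 1) = C (C u1 * X) := by simp [psi]
theorem psi2 : psi u0 u1 u2 h (zR 2) = C (C u2 * X) := by simp [psi]
theorem psi3 : psi u0 u1 u2 h (zR 3) = X := by simp [psi]

theorem psi_la2 (hL : (u0 - u1 + u2) ^ 2 - u1 * u2 = 0) : psi u0 u1 u2 h la2 = 0 := by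
  have e := congrArg (psi u0 u1 u2 h) ea2
  simp only [map_mul, map_sub, map_add, map_pow, map_ofNat, psi0, psi1, psi2, psi3] at e
  have := congrArg (fun x : K3 => (C (C x * X ^ 2) : K3[X][X])) hL
  simp only [C_add, C_sub, C_mul, C_pow, C_0, zero_mul] at this e
  linear_combination e + this - (psi u0 u1 u2 h la2 + C (C u1) * C (C u2) * C X ^ 2 + 4 * X) * h3T

theorem psi_la4 (hL : (u0 - u1 + u2) ^ 2 - u1 * u2 = 0)
    (β : K3) (hβ : u0 * u2 ^ 2 * (u0 - u1 + u2) + β = 0)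
    : psi u0 u1 u2 h la4 = C (C β * X ^ 4) := by
  have e := congrArg (psi u0 u1 u2 h) ea4
  simp only [map_mul, map_sub, map_add, map_pow, map_ofNat, psi0, psi1, psi2, psi3,
    psi_la2 u0 u1 u2 h hL] at e
  have := congrArg (fun x : K3 => (C (C x * X ^ 4) : K3[X][X])) hβ
  simp only [C_add, C_sub, C_mul, C_pow, C_0, zero_mul] at this e ⊢
  linear_combination (-1) * e - this + (psi u0 u1 u2 h la4 + 2 * X ^ 2) * h3T

theorem psi_la6 (hL : (u0 - u1 + u2) ^ 2 - u1 * u2 = 0)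
    (β : K3) (hβ : u0 * u2 ^ 2 * (u0 - u1 + u2) + β = 0)
    : psi u0 u1 u2 h la6 = zet (u0 ^ 2 * u2 ^ 4) β := by
  have e := congrArg (psi u0 u1 u2 h) ea6
  simp only [map_mul, map_sub, map_add, map_pow, map_ofNat, psi0, psi1, psi2, psi3,
    psi_la2 u0 u1 u2 h hL, psi_la4 u0 u1 u2 h hL β hβ] at e
  unfold zet
  simp only [C_mul, C_pow] at e ⊢
  linear_combination e - (psi u0 u1 u2 h la6 + X ^ 3 + X * C (C β) * C X ^ 4) * h3T

theorem psi_lam (hL : (u0 - u1 + u2) ^ 2 - u1 * u2 = 0)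
    (β : K3) (hβ : u0 * u2 ^ 2 * (u0 - u1 + u2) + β = 0)
    (f : Atilde) : psi u0 u1 u2 h (lam f) =
    ((ev0 f).map (phi β)).comp (zet (u0 ^ 2 * u2 ^ 4) β) := by
  induction f using MvPolynomial.induction_on with
  | C a =>
    rw [show lam (MvPolynomial.C a) = algebraMap _ _ a from by simp [lam]]
    simp [psi, ev0, phi]
  | add f g hf hg => simp only [map_add, hf, hg, Polynomial.map_add, add_comp]
  | mul_X f i hf =>
    simp only [map_mul, hf, Polynomial.map_mul, mul_comp]
    congr 1
    have hi : i = 0 ∨ i = 1 ∨ i = 2 := by omega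
    rcases hi with rfl | rfl | rfl
    · simp [lam, ev0, psi_la2 u0 u1 u2 h hL]
    · simp [lam, ev0, psi_la4 u0 u1 u2 h hL β hβ, phi]
    · simp [lam, ev0, psi_la6 u0 u1 u2 h hL β hβ]

end

theorem exists_alpha : ∃ α : K3, α ^ 3 - α + 1 = 0 := by
  have hd : (X ^ 3 - X + C (1 : K3)).degree ≠ 0 := by
    have : (X ^ 3 - X + C (1 : K3)).degree = 3 := by compute_degree!
    rw [this]; decide
  obtain ⟨α, hα⟩ := IsAlgClosed.exists_root (X ^ 3 - X + C (1 : K3)) hd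
  exact ⟨α, by simpa [IsRoot] using hα⟩

set_option maxHeartbeats 1000000 in
theorem stage (v : Atilde × (Fin 3 → Atilde) × (Fin 3 → Atilde) × Atilde) (y : Rring)
    (hv : Theta v = 3 * y) :
    ev0 v.1 = 0 ∧ (∀ i, ev0 (v.2.1 i) = 0) ∧ (∀ i, ev0 (v.2.2.1 i) = 0) ∧ ev0 v.2.2.2 = 0 := by
  obtain ⟨a, c, d, b⟩ := v
  simp only [Theta, σ₁R, σ₃R, n4R, n6R] at hv ⊢
  have h3 := h3K
  -- first specialization
  have hs1 : ev0 a = 0 ∧ ev0 (c 2 + b) = 0 := by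
    have r0 : (1 : K3) * 1 + 1 * 1 + 1 * 1 = 0 := by linear_combination h3
    have rL : ((1 : K3) - 1 + 1) ^ 2 - 1 * 1 = 0 := by ring
    have rβ : (1 : K3) * 1 ^ 2 * (1 - 1 + 1) + (-1) = 0 := by ring
    have e := congrArg (psi 1 1 1 r0) hv
    simp only [map_mul, map_sub, map_add, map_pow, map_ofNat, psi0, psi1, psi2, psi3,
      psi_lam 1 1 1 r0 rL (-1) rβ] at e
    set ζ := zet (1 ^ 2 * 1 ^ 4) (-1) with hζ
    apply phi_indep' (-1) (by simp) 0 6 (by decide)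
    refine (comp_indep ζ (zet_deg _ _) _ 0 0 ?_).1
    simp only [map_add, Polynomial.map_add, add_comp, mul_comp, pow_comp, C_comp, zero_comp, pow_zero, C_1,
      one_mul, C_pow, C_mul] at e ⊢
    generalize ((ev0 a).map (phi (-1))).comp ζ = p0 at *
    generalize ((ev0 (c 0)).map (phi (-1))).comp ζ = p1 at *
    generalize ((ev0 (c 1)).map (phi (-1))).comp ζ = p2 at *
    generalize ((ev0 (c 2)).map (phi (-1))).comp ζ = p3 at *
    generalize ((ev0 (d 0)).map (phi (-1))).comp ζ = p4 at *
    generalize ((ev0 (d 1)).map (phi (-1))).comp ζ = p5 at *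
    generalize ((ev0 (d 2)).map (phi (-1))).comp ζ = p6 at *
    generalize ((ev0 b).map (phi (-1))).comp ζ = p7 at *
    have hC : (C X + C X + C X : K3[X][X]) = 0 := by linear_combination (C X) * h3T
    simp only [hC] at e
    linear_combination e + (psi 1 1 1 r0 y + p2 * C X ^ 4 + 2 * p3 * C X ^ 4 * X) * h3T
  obtain ⟨ha, hcb⟩ := hs1
  obtain ⟨α, hα⟩ := exists_alpha
  have r0 : (α ^ 2 - α) * (α ^ 2 + α) + (α ^ 2 + α) * (α ^ 2 - 1) + (α ^ 2 - 1) * (α ^ 2 - α) = 0 := by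
    linear_combination (3 * α) * hα + (-α) * h3
  have rL : ((α ^ 2 - α) - (α ^ 2 + α) + (α ^ 2 - 1)) ^ 2 - (α ^ 2 + α) * (α ^ 2 - 1) = 0 := by
    linear_combination (-5) * hα + (2 + α ^ 2) * h3
  have rβ : (α ^ 2 - α) * (α ^ 2 - 1) ^ 2 * ((α ^ 2 - α) - (α ^ 2 + α) + (α ^ 2 - 1)) + 1 = 0 := by
    linear_combination (-2 + 2 * α + 3 * α ^ 2 - 3 * α ^ 4 + α ^ 5) * hα + (1 - α) * h3
  have rs : (α ^ 2 - α) + (α ^ 2 + α) + (α ^ 2 - 1) = -1 := by linear_combination α ^ 2 * h3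
  have r3 : (α ^ 2 - α) * (α ^ 2 + α) * (α ^ 2 - 1) = 1 := by
    linear_combination (-1 - α + α ^ 3) * hα
  generalize α ^ 2 - α = u0 at *
  generalize α ^ 2 + α = u1 at *
  generalize α ^ 2 - 1 = u2 at *
  have e := congrArg (psi u0 u1 u2 r0) hv
  simp only [map_mul, map_sub, map_add, map_pow, map_ofNat, psi0, psi1, psi2, psi3,
      psi_lam u0 u1 u2 r0 rL 1 rβ] at e
  have hb : ev0 b = - ev0 (c 2) := by
    rw [map_add] at hcb; linear_combination hcb
  rw [ha, hb] at e
  have hsum : (C (C u0 * X) + C (C u1 * X) + C (C u2 * X) : K3[X][X]) = -(C X : K3[X][X]) := by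
    rw [← C_add, ← C_add, ← add_mul, ← add_mul, ← C_add, ← C_add, rs]; simp
  have hprod : (C (C u0 * X) * C (C u1 * X) * C (C u2 * X) : K3[X][X]) = C X ^ 3 := by
    have := congrArg (fun x : K3 => (C (C x * X ^ 3) : K3[X][X])) r3
    simp only [C_mul, C_pow, C_1, one_mul] at this ⊢
    linear_combination this
  simp only [C_mul] at hsum hprod
  rw [hsum, hprod] at e
  set ζ := zet (u0 ^ 2 * u2 ^ 4) 1 with hζ
  obtain ⟨ν, hν⟩ : ∃ ν : K3[X], ν = - ((C u0 * X) ^ 3 * (C u2 * X)) - (C u0 * X) * (C u1 * X) ^ 3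
    - (C u0 * X) ^ 2 * (C u2 * X) ^ 2 := ⟨_, rfl⟩
  obtain ⟨μ, hμ⟩ : ∃ μ : K3[X], μ = 2 * (C u0 * X) ^ 3 * (C u2 * X) ^ 3
    - (C u0 * X) ^ 2 * (C u2 * X) ^ 4 := ⟨_, rfl⟩
  have hν' := congrArg (C : K3[X] → K3[X][X]) hν
  have hμ' := congrArg (C : K3[X] → K3[X][X]) hμ
  generalize hq1 : (ev0 (c 0)).map (phi 1) = q1 at *
  generalize hq2 : (ev0 (c 1)).map (phi 1) = q2 at *
  generalize hq3 : (ev0 (c 2)).map (phi 1) = q3 at *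
  generalize hq4 : (ev0 (d 0)).map (phi 1) = q4 at *
  generalize hq5 : (ev0 (d 1)).map (phi 1) = q5 at *
  generalize hq6 : (ev0 (d 2)).map (phi 1) = q6 at *
  have hind := comp_indep ζ (zet_deg _ _)
    (C (X ^ 2) * q1 + C ν * q2 + C μ * q3 + C (X ^ 4) * q4 + C (X ^ 2) * C ν * q5
      + C (X ^ 2) * C μ * q6 - C (X ^ 6) * q3)
    (C (X ^ 2) * q2 + 2 * C ν * q3 + C (X ^ 4) * q5 + 2 * C (X ^ 2) * C ν * q6)
    (C (X ^ 2) * q3 + C (X ^ 4) * q6) (by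
      have h2 : (2 : K3[X][X]).comp ζ = 2 := by
        simpa using C_comp (a := (2 : K3[X])) (p := ζ)
      simp only [add_comp, sub_comp, mul_comp, C_comp, h2]
      rw [Polynomial.map_neg, hq3, neg_comp, Polynomial.map_zero, zero_comp] at e
      simp only [C_mul, C_pow, C_sub, C_neg, C_ofNat] at e hν' hμ' ⊢
      rw [hν', hμ']
      linear_combination e + psi u0 u1 u2 r0 y * h3T)
  obtain ⟨i0, i1, i2⟩ := hind
  subst hq1 hq2 hq3 hq4 hq5 hq6
  obtain ⟨j3, j6⟩ := phi_indep' 1 one_ne_zero 2 4 (by decide) _ _ i2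
  rw [j3, j6] at i1 i0
  simp only [Polynomial.map_zero, mul_zero, add_zero, sub_zero] at i0 i1
  obtain ⟨j2, j5⟩ := phi_indep' 1 one_ne_zero 2 4 (by decide) _ _ i1
  rw [j2, j5] at i0
  simp only [Polynomial.map_zero, mul_zero, add_zero, sub_zero] at i0
  obtain ⟨j1, j4⟩ := phi_indep' 1 one_ne_zero 2 4 (by decide) _ _ i0
  refine ⟨ha, ?_, ?_, by rw [hb, j3, neg_zero]⟩
  · intro i; fin_cases i <;> assumption
  · intro i; fin_cases i <;> assumption

end Polynomial.PrfAux


namespace Prf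

abbrev V : Type := Atilde × (Fin 3 → Atilde) × (Fin 3 → Atilde) × Atilde

theorem Theta_add (v w : V) : Theta (v + w) = Theta v + Theta w := by
  simp only [Theta, Prod.fst_add, Prod.snd_add, Pi.add_apply, map_add]
  ring

theorem Theta_smul (c : Atilde) (v : V) : Theta (c • v) = lam c * Theta v := by
  simp only [Theta, Prod.smul_fst, Prod.smul_snd, Pi.smul_apply, smul_eq_mul, map_mul]
  ring

theorem Theta_zero : Theta 0 = 0 := by
  simp [Theta]

theorem Theta_neg (v : V) : Theta (-v) = -Theta v := by
  have := Theta_smul (-1) v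
  rw [neg_one_smul, map_neg, map_one] at this
  linear_combination this

theorem stage' (v : V) (y : Rring) (hv : Theta v = 3 * y) :
    ∃ u w : V, v = (3 : Atilde) • u + (X 0 : Atilde) • w := by
  obtain ⟨h1, h2, h3, h4⟩ := Polynomial.PrfAux.stage v y hv
  obtain ⟨u1, w1, e1⟩ := ev0_ker _ h1
  choose u2 w2 e2 using fun i => ev0_ker _ (h2 i)
  choose u3 w3 e3 using fun i => ev0_ker _ (h3 i)
  obtain ⟨u4, w4, e4⟩ := ev0_ker _ h4
  refine ⟨(u1, u2, u3, u4), (w1, w2, w3, w4), ?_⟩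
  refine Prod.ext e1 (Prod.ext (funext e2) (Prod.ext (funext e3) e4))

theorem iot3_la2 : iot red3 la2 ≠ 0 := by
  intro h
  have e := congrArg (iot red3) ea2
  simp only [map_mul, map_sub, map_add, map_pow, map_ofNat, h] at e
  have e2 := congrArg (MvPolynomial.eval ![1, 0, 0]) e
  simp [iot] at e2

theorem lamX0 : lam (X 0) = la2 := by simp [lam]

theorem strip (w : Rring) (n : ℕ) (y : Rring) (h : la2 ^ n * w = 3 * y) : ∃ y', w = 3 * y' := by
  apply iot3_ker
  have e := congrArg (iot red3) h
  simp only [map_mul, map_pow, map_ofNat] at e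
  have h3 : (3 : MvPolynomial (Fin 3) (ZMod 3)) = 0 := by
    have := congrArg (C : ZMod 3 → MvPolynomial (Fin 3) (ZMod 3)) (show (3 : ZMod 3) = 0 by decide)
    rwa [map_ofNat, map_zero] at this
  rw [h3, zero_mul] at e
  exact (mul_eq_zero.mp e).resolve_left (pow_ne_zero _ iot3_la2)

theorem stageN (v : V) (y : Rring) (hv : Theta v = 3 * y) (n : ℕ) :
    ∃ u w : V, v = (3 : Atilde) • u + (X 0 ^ n : Atilde) • w := by
  induction n with
  | zero => exact ⟨0, v, by simp⟩
  | succ n ih =>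
    obtain ⟨u, w, e⟩ := ih
    have h : la2 ^ n * Theta w = 3 * (y - Theta u) := by
      rw [e, Theta_add, Theta_smul, Theta_smul, map_pow, lamX0, map_ofNat] at hv
      linear_combination hv
    obtain ⟨y', hy⟩ := strip _ _ _ h
    obtain ⟨u', w', rfl⟩ := stage' w y' hy
    refine ⟨u + (X 0 ^ n : Atilde) • u', w', ?_⟩
    rw [e]
    simp only [smul_add, smul_smul, pow_succ, mul_comm (3 : Atilde), add_assoc]

theorem krull0 {A : Type*} [CommRing A] [IsDomain A] [IsNoetherianRing A] (t : A)
    (ht : ¬ IsUnit t) (f : A) (h : ∀ n : ℕ, t ^ n ∣ f) : f = 0 := by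
  have := Ideal.iInf_pow_eq_bot_of_isDomain (Ideal.span {t})
    (by rwa [Ne, Ideal.span_singleton_eq_top])
  have hm : f ∈ (⨅ i : ℕ, Ideal.span {t} ^ i) := by
    rw [Ideal.mem_iInf]
    intro i
    rw [Ideal.span_singleton_pow]
    exact Ideal.mem_span_singleton.mpr (h i)
  rw [this] at hm
  exact hm

theorem comp_div (f : Atilde) (h : ∀ n : ℕ, ∃ u w : Atilde, f = 3 * u + X 0 ^ n * w) :
    ∃ g, f = 3 * g := by
  apply map_red3_ker
  apply krull0 (X 0 : MvPolynomial (Fin 3) (ZMod 3))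
  · intro hu
    have := hu.map (MvPolynomial.eval (0 : Fin 3 → ZMod 3))
    simp at this
  · intro n
    obtain ⟨u, w, e⟩ := h n
    have h3 : (3 : MvPolynomial (Fin 3) (ZMod 3)) = 0 := by
      have := congrArg (C : ZMod 3 → MvPolynomial (Fin 3) (ZMod 3))
        (show (3 : ZMod 3) = 0 by decide)
      rwa [map_ofNat, map_zero] at this
    rw [e]
    simp only [map_add, map_mul, map_ofNat, h3, zero_mul, zero_add, map_pow, map_X]
    exact dvd_mul_right _ _

theorem sat3 (v : V) (y : Rring) (hv : Theta v = 3 * y) :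
    ∃ v' : V, v = (3 : Atilde) • v' ∧ Theta v' = y := by
  have key := stageN v y hv
  choose u w e using key
  obtain ⟨g1, e1⟩ := comp_div v.1 fun n => ⟨(u n).1, (w n).1, congrArg (fun v : V => v.1) (e n)⟩
  choose g2 e2 using fun i => comp_div (v.2.1 i) fun n =>
    ⟨(u n).2.1 i, (w n).2.1 i, congrArg (fun v : V => v.2.1 i) (e n)⟩
  choose g3 e3 using fun i => comp_div (v.2.2.1 i) fun n =>
    ⟨(u n).2.2.1 i, (w n).2.2.1 i, congrArg (fun v : V => v.2.2.1 i) (e n)⟩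
  obtain ⟨g4, e4⟩ := comp_div v.2.2.2 fun n =>
    ⟨(u n).2.2.2, (w n).2.2.2, congrArg (fun v : V => v.2.2.2) (e n)⟩
  have hh : v = (3 : Atilde) • ((g1, g2, g3, g4) : V) :=
    Prod.ext e1 (Prod.ext (funext e2) (Prod.ext (funext e3) e4))
  refine ⟨(g1, g2, g3, g4), hh, ?_⟩
  rw [hh, Theta_smul, map_ofNat] at hv
  exact mul_left_cancel₀ (by exact_mod_cast (Nat.cast_ne_zero (R := Rring)).mpr (show 3 ≠ 0 by norm_num)) hv

theorem three_not_unit : ¬ IsUnit (3 : Atilde) := by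
  intro hu
  have := hu.map (eval₂Hom red3 (0 : Fin 3 → ZMod 3))
  rw [map_ofNat] at this
  exact absurd (this.ne_zero) (by decide)

theorem ker_trivial (v : V) (hv : Theta v = 0) : v = 0 := by
  have key : ∀ n : ℕ, ∃ w : V, v = (3 ^ n : Atilde) • w ∧ Theta w = 0 := by
    intro n
    induction n with
    | zero => exact ⟨v, by simp, hv⟩
    | succ n ih =>
      obtain ⟨w, hw, hw0⟩ := ih
      obtain ⟨w', rfl, h'⟩ := sat3 w 0 (by rw [hw0, mul_zero])
      exact ⟨w', by rw [hw, smul_smul, pow_succ], h'⟩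
  choose w e _ using key
  refine Prod.ext ?_ (Prod.ext (funext fun i => ?_) (Prod.ext (funext fun i => ?_) ?_))
  · exact krull0 3 three_not_unit _ fun n => ⟨(w n).1, congrArg (fun v : V => v.1) (e n)⟩
  · exact krull0 3 three_not_unit _ fun n => ⟨(w n).2.1 i, congrArg (fun v : V => v.2.1 i) (e n)⟩
  · exact krull0 3 three_not_unit _ fun n =>
      ⟨(w n).2.2.1 i, congrArg (fun v : V => v.2.2.1 i) (e n)⟩
  · exact krull0 3 three_not_unit _ fun n => ⟨(w n).2.2.2, congrArg (fun v : V => v.2.2.2) (e n)⟩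

theorem Theta_inj : Function.Injective Theta := by
  intro v w h
  have : Theta (v - w) = 0 := by rw [sub_eq_add_neg, Theta_add, Theta_neg, h, add_neg_cancel]
  exact sub_eq_zero.mp (ker_trivial _ this)

theorem range_sat (n : ℕ) : n ≠ 0 → ∀ (x : Rring) (v : V), (n : Rring) * x = Theta v →
    ∃ v', Theta v' = x := by
  induction n using Nat.strong_induction_on with
  | _ n ih =>
    intro hn x v h
    by_cases h3 : 3 ∣ n
    · obtain ⟨m, rfl⟩ := h3
      push_cast at h
      obtain ⟨v', -, hv'⟩ := sat3 v (m * x) (by rw [← h]; ring)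
      exact ih m (by omega) (by omega) x v' hv'.symm
    · have hu := isUnit_of_not_dvd (n : ℤ) (by omega)
      obtain ⟨c, hc⟩ := hu.exists_left_inv
      refine ⟨(C c : Atilde) • v, ?_⟩
      rw [Theta_smul, ← h, ← mul_assoc]
      have h1 : lam (C c) * (n : Rring) = 1 := by
        have := congrArg (fun t => lam (C t)) hc
        simpa using this
      rw [h1, one_mul]

end Prf


namespace Prf

/-! ### Evaluation through the embedding -/

theorem iz0 : iot (RingHom.id Z3loc) (zR 0) = X 0 * X 1 := by simp [iot]
theorem iz1 : iot (RingHom.id Z3loc) (zR 1) = -X 0 ^ 2 - X 0 * X 1 := by simp [iot]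
theorem iz2 : iot (RingHom.id Z3loc) (zR 2) = - X 0 * X 1 - X 1 ^ 2 := by simp [iot]
theorem iz3 : iot (RingHom.id Z3loc) (zR 3) = X 2 ^ 2 := by simp [iot]

noncomputable def wR : Rring :=
  (zR 0 ^ 2 * zR 1 + zR 1 ^ 2 * zR 2 + zR 2 ^ 2 * zR 0)
    - (zR 0 * zR 1 ^ 2 + zR 1 * zR 2 ^ 2 + zR 2 * zR 0 ^ 2)

noncomputable def C4A : Atilde := 16 * (X 0 ^ 2 - 3 * X 1)
noncomputable def C6A : Atilde := 64 * (2 * X 0 ^ 3 - 9 * X 0 * X 1 + 27 * X 2)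

theorem lamX1 : lam (X 1) = la4 := by simp [lam]
theorem lamX2 : lam (X 2) = la6 := by simp [lam]

noncomputable def N4 : Rring := 4 * (3 * n4R + σ₁R ^ 2 * la2)
noncomputable def N6 : Rring := 16 * (9 * n6R + 6 * la2 * n4R + la2 ^ 2 * σ₁R ^ 2)

theorem hw : wR ^ 2 + 4 * σ₁R ^ 3 * σ₃R + 27 * σ₃R ^ 2 = 0 := by
  apply iot_injective
  simp only [wR, σ₁R, σ₃R, map_add, map_sub, map_mul, map_pow, map_ofNat, map_zero,
    iz0, iz1, iz2]
  ring

theorem hC4 : lam C4A = σ₁R ^ 4 - 4 * σ₁R * σ₃R - 4 * σ₁R * wR := by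
  simp only [C4A, map_add, map_sub, map_mul, map_pow, map_ofNat, lamX0, lamX1]
  have : 16 * (la2 ^ 2 - 3 * la4) = (4 * la2) ^ 2 - 24 * (2 * la4) := by ring
  rw [this, ea4, ea2]
  apply iot_injective
  simp only [wR, σ₁R, σ₃R, map_add, map_sub, map_mul, map_pow, map_ofNat, map_zero,
    iz0, iz1, iz2, iz3]
  ring

theorem hC6 : lam C6A = 2 * σ₁R ^ 6 - 60 * σ₁R ^ 3 * σ₃R - 216 * σ₃R ^ 2 - 12 * σ₁R ^ 3 * wR
    - 8 * σ₃R * wR := by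
  simp only [C6A, map_add, map_sub, map_mul, map_pow, map_ofNat, lamX0, lamX1, lamX2]
  have : 64 * (2 * la2 ^ 3 - 9 * la2 * la4 + 27 * la6)
    = 2 * (4 * la2) ^ 3 - 72 * (4 * la2) * (2 * la4) + 432 * (4 * la6) := by ring
  rw [this, ea6, ea4, ea2]
  apply iot_injective
  simp only [wR, σ₁R, σ₃R, map_add, map_sub, map_mul, map_pow, map_ofNat, map_zero,
    iz0, iz1, iz2, iz3]
  ring

theorem hN4 : N4 = σ₁R ^ 4 + 12 * σ₁R * σ₃R + 4 * σ₁R * wR := by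
  have : N4 = 12 * n4R + σ₁R ^ 2 * (4 * la2) := by unfold N4; ring
  rw [this, ea2]
  apply iot_injective
  simp only [wR, σ₁R, σ₃R, n4R, map_add, map_sub, map_mul, map_pow, map_ofNat, map_zero,
    iz0, iz1, iz2, iz3]
  ring

theorem hN6 : N6 = σ₁R ^ 6 + 104 * σ₁R ^ 3 * σ₃R + 360 * σ₃R ^ 2 + 8 * σ₁R ^ 3 * wR
    + 24 * σ₃R * wR := by
  have : N6 = 144 * n6R + 24 * (4 * la2) * n4R + (4 * la2) ^ 2 * σ₁R ^ 2 := by unfold N6; ring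
  rw [this, ea2]
  apply iot_injective
  simp only [wR, σ₁R, σ₃R, n4R, n6R, map_add, map_sub, map_mul, map_pow, map_ofNat, map_zero,
    iz0, iz1, iz2, iz3]
  ring

/-! ### The image of Theta -/

def InM (x : Rring) : Prop := ∃ v : V, Theta v = x

theorem M_add {x y : Rring} : InM x → InM y → InM (x + y) := by
  rintro ⟨v, rfl⟩ ⟨w, rfl⟩
  exact ⟨v + w, Theta_add v w⟩

theorem M_lam (c : Atilde) {x : Rring} : InM x → InM (lam c * x) := by
  rintro ⟨v, rfl⟩
  exact ⟨c • v, Theta_smul c v⟩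

theorem M_div (n : ℕ) (hn : n ≠ 0) {x : Rring} : InM ((n : Rring) * x) → InM x := by
  rintro ⟨v, hv⟩
  exact range_sat n hn x v hv.symm

theorem M_zero : InM 0 := ⟨0, Theta_zero⟩

theorem M_comb (A0 A1 A2 A3 A4 A5 A6 A7 : Atilde) : InM (lam A0 + lam A1 * σ₁R ^ 2 + lam A2 * N4
    + lam A3 * N6 + lam A4 * σ₁R ^ 4 + lam A5 * (σ₁R ^ 2 * N4) + lam A6 * (σ₁R ^ 2 * N6)
    + lam A7 * σ₃R ^ 2) := by
  refine ⟨(A0, ![A1 + 4 * A2 * X 0 + 16 * A3 * X 0 ^ 2, 12 * A2 + 96 * A3 * X 0, 144 * A3],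
    ![A4 + 4 * A5 * X 0 + 16 * A6 * X 0 ^ 2, 12 * A5 + 96 * A6 * X 0, 144 * A6], A7), ?_⟩
  simp only [Theta, Matrix.cons_val, map_add, map_mul, map_pow, map_ofNat, lamX0, N4, N6]
  ring

theorem M_of (n : ℕ) (hn : n ≠ 0) (x : Rring) (A0 A1 A2 A3 A4 A5 A6 A7 : Atilde)
    (h : (n : Rring) * x = lam A0 + lam A1 * σ₁R ^ 2 + lam A2 * N4
    + lam A3 * N6 + lam A4 * σ₁R ^ 4 + lam A5 * (σ₁R ^ 2 * N4) + lam A6 * (σ₁R ^ 2 * N6)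
    + lam A7 * σ₃R ^ 2) : InM x :=
  M_div n hn (h ▸ M_comb A0 A1 A2 A3 A4 A5 A6 A7)

theorem m_s6 : InM (σ₁R ^ 6) := by
  refine M_of 12 (by norm_num) _ (3 * C6A) (-C4A) 0 1 0 6 0 288 ?_
  simp only [map_mul, map_neg, map_ofNat, map_zero, map_one, hC4, hC6, hN4, hN6, Nat.cast_ofNat]
  ring

theorem m_s4N4 : InM (σ₁R ^ 4 * N4) := by
  refine M_of 3 (by norm_num) _ (-3 * C4A ^ 2) (14 * C6A) (-C4A) 0 (-27 * C4A) 0 6 0 ?_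
  simp only [map_mul, map_neg, map_pow, map_ofNat, map_zero, map_one, hC4, hC6, hN4, hN6,
    Nat.cast_ofNat]
  linear_combination (32 * σ₁R ^ 2) * hw

theorem m_s4N6 : InM (σ₁R ^ 4 * N6) := by
  refine M_of 12 (by norm_num) _ (-5523 * C4A * C6A) (11577 * C4A ^ 2) (-952 * C6A) (-2113 * C4A)
    (1092 * C6A) (1314 * C4A) 0 (-197280 * C4A) ?_
  simp only [map_mul, map_neg, map_pow, map_ofNat, map_zero, map_one, hC4, hC6, hN4, hN6,
    Nat.cast_ofNat]
  linear_combination (-56576 * σ₁R * σ₃R - 12416 * σ₁R ^ 4) * hw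

theorem m_s2e2 : InM (σ₁R ^ 2 * σ₃R ^ 2) := by
  refine M_of 1632 (by norm_num) _ (-18 * C4A ^ 2) (11 * C6A) (-10 * C4A) 0 (5 * C4A) 0 1 0 ?_
  simp only [map_mul, map_neg, map_pow, map_ofNat, map_zero, map_one, hC4, hC6, hN4, hN6,
    Nat.cast_ofNat]
  linear_combination (128 * σ₁R ^ 2) * hw

theorem m_e2N4 : InM (σ₃R ^ 2 * N4) := by
  refine M_of 96 (by norm_num) _ (-45 * C4A * C6A) (93 * C4A ^ 2) (-8 * C6A) (-17 * C4A)
    (10 * C6A) (10 * C4A) 0 (-1728 * C4A) ?_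
  simp only [map_mul, map_neg, map_pow, map_ofNat, map_zero, map_one, hC4, hC6, hN4, hN6,
    Nat.cast_ofNat]
  linear_combination (-448 * σ₁R * σ₃R - 96 * σ₁R ^ 4) * hw

theorem m_e2N6 : InM (σ₃R ^ 2 * N6) := by
  refine M_of 11424 (by norm_num) _ (-34 * C6A ^ 2 - 98 * C4A ^ 3) (109 * C4A * C6A) (6 * C4A ^ 2)
    (-34 * C6A) (201 * C4A ^ 2) (-136 * C6A) (149 * C4A) (-14688 * C6A) ?_
  simp only [map_mul, map_neg, map_sub, map_pow, map_ofNat, map_zero, map_one, hC4, hC6, hN4, hN6,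
    Nat.cast_ofNat]
  linear_combination (-4352 * σ₃R ^ 2 - 6656 * σ₁R ^ 3 * wR - 19712 * σ₁R ^ 3 * σ₃R
    - 3776 * σ₁R ^ 6) * hw

theorem m_e4 : InM (σ₃R ^ 4) := by
  refine M_of 3290112 (by norm_num) _ (391 * C6A ^ 2 + 56 * C4A ^ 3) (-837 * C4A * C6A)
    (288 * C4A ^ 2) (153 * C6A) (-348 * C4A ^ 2) (-102 * C6A) (12 * C4A) (14688 * C6A) ?_
  simp only [map_mul, map_neg, map_add, map_pow, map_ofNat, map_zero, map_one, hC4, hC6, hN4, hN6,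
    Nat.cast_ofNat]
  linear_combination (4352 * σ₃R ^ 2 - 14848 * σ₁R ^ 3 * wR - 77952 * σ₁R ^ 3 * σ₃R
    + 1536 * σ₁R ^ 6) * hw

theorem m_se : InM (σ₁R * σ₃R) := by
  refine M_of 8 (by norm_num) _ C4A 0 1 0 (-2) 0 0 0 ?_
  simp only [map_mul, map_neg, map_ofNat, map_zero, map_one, hC4, hN4, Nat.cast_ofNat]
  ring

theorem m_sw : InM (σ₁R * wR) := by
  refine M_of 8 (by norm_num) _ (-3 * C4A) 0 (-1) 0 4 0 0 0 ?_
  simp only [map_mul, map_neg, map_ofNat, map_zero, map_one, hC4, hN4, Nat.cast_ofNat]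
  ring

theorem m_ew : InM (σ₃R * wR) := by
  refine M_of 96 (by norm_num) _ (21 * C6A) (-47 * C4A) 0 11 0 (-6) 0 576 ?_
  simp only [map_mul, map_neg, map_ofNat, map_zero, map_one, hC4, hC6, hN4, hN6, Nat.cast_ofNat]
  ring

theorem m_1 : InM 1 := by
  refine M_of 1 (by norm_num) _ 1 0 0 0 0 0 0 0 ?_
  simp

theorem m_s2 : InM (σ₁R ^ 2) := by
  refine M_of 1 (by norm_num) _ 0 1 0 0 0 0 0 0 ?_
  simp

theorem m_e2 : InM (σ₃R ^ 2) := by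
  refine M_of 1 (by norm_num) _ 0 0 0 0 0 0 0 1 ?_
  simp

/-- if `t`, `t N4`, `t N6` times something lie in the image then so do `t n4`, `t n6`. -/
theorem m_n4 (t : Rring) (h1 : InM (t * σ₁R ^ 2)) (h2 : InM (t * N4)) : InM (t * n4R) := by
  refine M_div 12 (by norm_num) ?_
  convert M_add h2 (M_lam (-4 * X 0) h1) using 1
  simp only [map_mul, map_neg, map_ofNat, lamX0, N4, Nat.cast_ofNat]
  ring

theorem m_n6 (t : Rring) (h1 : InM (t * σ₁R ^ 2)) (h2 : InM (t * N4)) (h3 : InM (t * N6)) :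
    InM (t * n6R) := by
  refine M_div 144 (by norm_num) ?_
  convert M_add h3 (M_add (M_lam (-96 * X 0) (m_n4 t h1 h2)) (M_lam (-16 * X 0 ^ 2) h1)) using 1
  simp only [map_mul, map_neg, map_pow, map_ofNat, lamX0, N6, Nat.cast_ofNat]
  ring

theorem M_mul_of (t : Rring) (h0 : InM t) (h1 : InM (t * σ₁R ^ 2)) (h2 : InM (t * n4R))
    (h3 : InM (t * n6R)) (h4 : InM (t * σ₁R ^ 4)) (h5 : InM (t * (σ₁R ^ 2 * n4R)))
    (h6 : InM (t * (σ₁R ^ 2 * n6R))) (h7 : InM (t * σ₃R ^ 2)) {x : Rring} (hx : InM x) :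
    InM (t * x) := by
  obtain ⟨⟨a, c, d, b⟩, rfl⟩ := hx
  convert M_add (M_lam a h0) (M_add (M_lam (c 0) h1) (M_add (M_lam (c 1) h2)
    (M_add (M_lam (c 2) h3) (M_add (M_lam (d 0) h4) (M_add (M_lam (d 1) h5)
    (M_add (M_lam (d 2) h6) (M_lam b h7))))))) using 1
  simp only [Theta]
  ring

theorem m_b1 : InM n4R := by
  refine ⟨(0, ![0, 1, 0], 0, 0), ?_⟩
  simp [Theta]

theorem m_b2 : InM n6R := by
  refine ⟨(0, ![0, 0, 1], 0, 0), ?_⟩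
  simp [Theta]

theorem m_b3 : InM (σ₁R ^ 2 * n4R) := by
  refine ⟨(0, 0, ![0, 1, 0], 0), ?_⟩
  simp [Theta]

theorem m_b4 : InM (σ₁R ^ 2 * n6R) := by
  refine ⟨(0, 0, ![0, 0, 1], 0), ?_⟩
  simp [Theta]

theorem m_b5 : InM (σ₁R ^ 4) := by
  refine ⟨(0, 0, ![1, 0, 0], 0), ?_⟩
  simp [Theta]

theorem M_s2 {x : Rring} (hx : InM x) : InM (σ₁R ^ 2 * x) := by
  have h6 : InM (σ₁R ^ 4 * σ₁R ^ 2) := by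
    rw [← pow_add]; exact m_s6
  refine M_mul_of (σ₁R ^ 2) m_s2 ?_ m_b3 m_b4 ?_ ?_ ?_ m_s2e2 hx
  · rw [← pow_add]; exact m_b5
  · rw [← pow_add]; exact m_s6
  · rw [← mul_assoc, ← pow_add]
    exact m_n4 _ h6 m_s4N4
  · rw [← mul_assoc, ← pow_add]
    exact m_n6 _ h6 m_s4N4 m_s4N6

theorem M_e2 {x : Rring} (hx : InM x) : InM (σ₃R ^ 2 * x) := by
  have h2 : InM (σ₃R ^ 2 * σ₁R ^ 2) := by
    rw [mul_comm]; exact m_s2e2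
  have h4 := m_n4 _ h2 m_e2N4
  have h6 := m_n6 _ h2 m_e2N4 m_e2N6
  refine M_mul_of (σ₃R ^ 2) m_e2 h2 h4 h6 ?_ ?_ ?_ ?_ hx
  · convert M_s2 h2 using 1; ring
  · convert M_s2 h4 using 1; ring
  · convert M_s2 h6 using 1; ring
  · rw [← pow_add]; exact m_e4

theorem M_s2k (k : ℕ) {x : Rring} (hx : InM x) : InM ((σ₁R ^ 2) ^ k * x) := by
  induction k with
  | zero => simpa using hx
  | succ k ih =>
    convert M_s2 ih using 1
    ring

theorem M_e2k (k : ℕ) {x : Rring} (hx : InM x) : InM ((σ₃R ^ 2) ^ k * x) := by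
  induction k with
  | zero => simpa using hx
  | succ k ih =>
    convert M_e2 ih using 1
    ring

theorem M_even (i j : ℕ) (h : Even (i + j)) : InM (σ₁R ^ i * σ₃R ^ j) := by
  rcases Nat.even_or_odd' i with ⟨a, rfl | rfl⟩ <;> rcases Nat.even_or_odd' j with ⟨b, rfl | rfl⟩
  · convert M_s2k a (M_e2k b m_1) using 1; ring
  · exfalso; rw [Nat.even_iff] at h; omega
  · exfalso; rw [Nat.even_iff] at h; omega
  · convert M_s2k a (M_e2k b m_se) using 1; ring

theorem M_odd (i j : ℕ) (h : Odd (i + j)) : InM (σ₁R ^ i * σ₃R ^ j * wR) := by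
  rcases Nat.even_or_odd' i with ⟨a, rfl | rfl⟩ <;> rcases Nat.even_or_odd' j with ⟨b, rfl | rfl⟩
  · exfalso; rw [Nat.odd_iff] at h; omega
  · convert M_s2k a (M_e2k b m_ew) using 1; ring
  · convert M_s2k a (M_e2k b m_sw) using 1; ring
  · exfalso; rw [Nat.odd_iff] at h; omega

end Prf


namespace Prf

/-! ### A generating family up to integer multiples -/

noncomputable def ev : MvPolynomial (Fin 3) Z3loc →ₐ[Z3loc] Rring := aeval ![la2, σ₁R, σ₃R]

theorem evX0 : ev (X 0) = la2 := by simp [ev]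
theorem evX1 : ev (X 1) = σ₁R := by simp [ev]
theorem evX2 : ev (X 2) = σ₃R := by simp [ev]

def Gen (x : Rring) : Prop := ∃ n : ℕ, n ≠ 0 ∧ ∃ p0 p1 p2 q0 q1 q2 : MvPolynomial (Fin 3) Z3loc,
  (n : Rring) * x = ev p0 + ev p1 * zR 0 + ev p2 * zR 0 ^ 2
    + (ev q0 + ev q1 * zR 0 + ev q2 * zR 0 ^ 2) * zR 1

theorem hcub : zR 0 ^ 3 - σ₁R * zR 0 ^ 2 - σ₃R = 0 := by
  unfold σ₁R σ₃R
  linear_combination (-zR 0) * hrel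

theorem hquad : zR 1 ^ 2 - σ₁R * zR 0 - σ₁R * zR 1 + zR 0 * zR 1 + zR 0 ^ 2 = 0 := by
  unfold σ₁R
  linear_combination (-1) * hrel

theorem Gen_add {x y : Rring} : Gen x → Gen y → Gen (x + y) := by
  rintro ⟨n, hn, p0, p1, p2, q0, q1, q2, h⟩ ⟨m, hm, a0, a1, a2, b0, b1, b2, h'⟩
  refine ⟨n * m, mul_ne_zero hn hm, m * p0 + n * a0, m * p1 + n * a1, m * p2 + n * a2,
    m * q0 + n * b0, m * q1 + n * b1, m * q2 + n * b2, ?_⟩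
  simp only [map_add, map_mul, map_natCast, Nat.cast_mul]
  linear_combination (m : Rring) * h + (n : Rring) * h'

theorem Gen_ev (c : MvPolynomial (Fin 3) Z3loc) {x : Rring} : Gen x → Gen (ev c * x) := by
  rintro ⟨n, hn, p0, p1, p2, q0, q1, q2, h⟩
  refine ⟨n, hn, c * p0, c * p1, c * p2, c * q0, c * q1, c * q2, ?_⟩
  simp only [map_mul]
  linear_combination (ev c) * h

theorem Gen_div (n : ℕ) (hn : n ≠ 0) {x : Rring} : Gen ((n : Rring) * x) → Gen x := by
  rintro ⟨m, hm, p0, p1, p2, q0, q1, q2, h⟩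
  refine ⟨m * n, mul_ne_zero hm hn, p0, p1, p2, q0, q1, q2, ?_⟩
  push_cast
  linear_combination h

theorem Gen_z0 {x : Rring} : Gen x → Gen (zR 0 * x) := by
  rintro ⟨n, hn, p0, p1, p2, q0, q1, q2, h⟩
  refine ⟨n, hn, X 2 * p2, p0, p1 + X 1 * p2, X 2 * q2, q0, q1 + X 1 * q2, ?_⟩
  simp only [map_mul, map_add, evX1, evX2]
  linear_combination (zR 0) * h + (ev p2 + ev q2 * zR 1) * hcub

theorem Gen_z1 {x : Rring} : Gen x → Gen (zR 1 * x) := by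
  rintro ⟨n, hn, p0, p1, p2, q0, q1, q2, h⟩
  refine ⟨n, hn, X 1 * (X 2 * q2) - X 2 * (q1 + X 1 * q2), X 1 * q0 - X 2 * q2,
    X 1 * (q1 + X 1 * q2) - (q0 + X 1 * (q1 + X 1 * q2)),
    p0 + X 1 * q0 - X 2 * q2, p1 + X 1 * q1 - q0, p2 + X 1 * q2 - (q1 + X 1 * q2), ?_⟩
  simp only [map_mul, map_add, map_sub, evX1, evX2]
  linear_combination (zR 1) * h + (ev q0 + ev q1 * zR 0 + ev q2 * zR 0 ^ 2) * hquad
    - (ev q2 * zR 0 + ev q1 + ev q2 * zR 1) * hcub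

theorem Gen_neg {x : Rring} (h : Gen x) : Gen (-x) := by
  have := Gen_ev (-1) h
  rw [map_neg, map_one] at this
  convert this using 1
  ring

theorem Gen_z2 {x : Rring} (h : Gen x) : Gen (zR 2 * x) := by
  have := Gen_add (Gen_ev (X 1) h) (Gen_neg (Gen_add (Gen_z0 h) (Gen_z1 h)))
  rw [evX1] at this
  convert this using 1
  unfold σ₁R
  ring

theorem Gen_z3 {x : Rring} (h : Gen x) : Gen (zR 3 * x) := by
  refine Gen_div 12 (by norm_num) ?_
  have hD : ∀ {y}, Gen y → Gen ((zR 0 - zR 1 + zR 2) * y) := by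
    intro y hy
    convert Gen_add (Gen_z0 hy) (Gen_add (Gen_neg (Gen_z1 hy)) (Gen_z2 hy)) using 1
    ring
  have := Gen_add (hD (hD h)) (Gen_neg (Gen_ev 4 (Gen_add (Gen_z1 (Gen_z2 h)) (Gen_ev (X 0) h))))
  rw [evX0, map_ofNat] at this
  convert this using 1
  push_cast
  linear_combination x * ea2

theorem Gen_all (x : Rring) : Gen x := by
  induction x using R_induction with
  | hC c => exact ⟨1, one_ne_zero, C c, 0, 0, 0, 0, 0, by simp [ev]⟩
  | hadd x y hx hy => exact Gen_add hx hy
  | hmul x i hx =>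
    rw [mul_comm]
    have hi : i = 0 ∨ i = 1 ∨ i = 2 ∨ i = 3 := by omega
    rcases hi with rfl | rfl | rfl | rfl
    · exact Gen_z0 hx
    · exact Gen_z1 hx
    · exact Gen_z2 hx
    · exact Gen_z3 hx

/-! ### The action of tau -/

theorem npow_even {B : Type*} [CommRing B] (n : ℕ) (h : Even n) : (-1 : B) ^ n = 1 :=
  h.neg_one_pow

theorem npow_odd {B : Type*} [CommRing B] (n : ℕ) (h : Odd n) : (-1 : B) ^ n = -1 :=
  h.neg_one_pow

section tau
theorem tau_s (τ : Rring ≃ₐ[Z3loc] Rring)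
    (h1 : τ (zR 0) = -zR 2) (h2 : τ (zR 1) = -zR 0) (h3 : τ (zR 2) = -zR 1)
    : τ σ₁R = -σ₁R := by
  simp only [σ₁R, map_add, h1, h2, h3]
  ring

theorem tau_e (τ : Rring ≃ₐ[Z3loc] Rring)
    (h1 : τ (zR 0) = -zR 2) (h2 : τ (zR 1) = -zR 0) (h3 : τ (zR 2) = -zR 1)
    : τ σ₃R = -σ₃R := by
  simp only [σ₃R, map_mul, h1, h2, h3]
  ring

theorem tau_w (τ : Rring ≃ₐ[Z3loc] Rring)
    (h1 : τ (zR 0) = -zR 2) (h2 : τ (zR 1) = -zR 0) (h3 : τ (zR 2) = -zR 1)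
    : τ wR = -wR := by
  simp only [wR, map_mul, map_add, map_sub, map_pow, h1, h2, h3]
  ring

theorem tau_la2 (τ : Rring ≃ₐ[Z3loc] Rring)
    (h1 : τ (zR 0) = -zR 2) (h2 : τ (zR 1) = -zR 0) (h3 : τ (zR 2) = -zR 1)
    (h4 : τ (zR 3) = zR 3 + zR 1 * zR 2)
    : τ la2 = la2 := by
  have h : (4 : Rring) * τ la2 = 4 * la2 := by
    have := congrArg τ ea2
    rw [map_mul, map_ofNat] at this
    rw [this, ea2]
    simp only [map_mul, map_add, map_sub, map_pow, map_ofNat, h1, h2, h3, h4]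
    apply iot_injective
    simp only [map_add, map_sub, map_mul, map_neg, map_pow, map_ofNat, map_zero,
      iz0, iz1, iz2, iz3]
    ring
  linear_combination (Ring.inverse 4) * h + (la2 - τ la2) * four_inv

theorem tau_la4 (τ : Rring ≃ₐ[Z3loc] Rring)
    (h1 : τ (zR 0) = -zR 2) (h2 : τ (zR 1) = -zR 0) (h3 : τ (zR 2) = -zR 1)
    (h4 : τ (zR 3) = zR 3 + zR 1 * zR 2)
    : τ la4 = la4 := by
  have h : (2 : Rring) * τ la4 = 2 * la4 := by
    have := congrArg τ ea4
    rw [map_mul, map_ofNat] at this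
    rw [this, ea4]
    simp only [map_mul, map_add, map_sub, map_pow, map_ofNat, h1, h2, h3, h4,
      tau_la2 τ h1 h2 h3 h4]
    rw [ea2]
    apply iot_injective
    simp only [map_add, map_sub, map_mul, map_neg, map_pow, map_ofNat, map_zero,
      iz0, iz1, iz2, iz3]
    ring
  linear_combination (Ring.inverse 2) * h + (la4 - τ la4) * two_inv

theorem tau_la6 (τ : Rring ≃ₐ[Z3loc] Rring)
    (h1 : τ (zR 0) = -zR 2) (h2 : τ (zR 1) = -zR 0) (h3 : τ (zR 2) = -zR 1)
    (h4 : τ (zR 3) = zR 3 + zR 1 * zR 2)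
    : τ la6 = la6 := by
  have h : (4 : Rring) * τ la6 = 4 * la6 := by
    have := congrArg τ ea6
    rw [map_mul, map_ofNat] at this
    rw [this, ea6]
    simp only [map_mul, map_add, map_sub, map_pow, map_ofNat, h1, h2, h3, h4,
      tau_la2 τ h1 h2 h3 h4, tau_la4 τ h1 h2 h3 h4]
    rw [ea4, ea2]
    apply iot_injective
    simp only [map_add, map_sub, map_mul, map_neg, map_pow, map_ofNat, map_zero,
      iz0, iz1, iz2, iz3]
    ring
  linear_combination (Ring.inverse 4) * h + (la6 - τ la6) * four_inv

theorem tau_lam (τ : Rring ≃ₐ[Z3loc] Rring)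
    (h1 : τ (zR 0) = -zR 2) (h2 : τ (zR 1) = -zR 0) (h3 : τ (zR 2) = -zR 1)
    (h4 : τ (zR 3) = zR 3 + zR 1 * zR 2)
    (f : Atilde) : τ (lam f) = lam f := by
  induction f using MvPolynomial.induction_on with
  | C a => simp [lam]
  | add f g hf hg => simp only [map_add, hf, hg]
  | mul_X f i hf =>
    simp only [map_mul, hf]
    congr 1
    have hi : i = 0 ∨ i = 1 ∨ i = 2 := by omega
    rcases hi with rfl | rfl | rfl
    · rw [lamX0, tau_la2 τ h1 h2 h3 h4]
    · rw [lamX1, tau_la4 τ h1 h2 h3 h4]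
    · rw [lamX2, tau_la6 τ h1 h2 h3 h4]

theorem tau_n4 (τ : Rring ≃ₐ[Z3loc] Rring)
    (h1 : τ (zR 0) = -zR 2) (h2 : τ (zR 1) = -zR 0) (h3 : τ (zR 2) = -zR 1)
    (h4 : τ (zR 3) = zR 3 + zR 1 * zR 2)
    : τ n4R = n4R := by
  simp only [n4R, map_mul, map_add, map_sub, map_pow, map_ofNat, h1, h2, h3, h4,
    tau_s τ h1 h2 h3]
  apply iot_injective
  simp only [σ₁R, map_add, map_sub, map_mul, map_neg, map_pow, map_ofNat, map_zero,
      iz0, iz1, iz2, iz3]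
  ring

theorem tau_n6 (τ : Rring ≃ₐ[Z3loc] Rring)
    (h1 : τ (zR 0) = -zR 2) (h2 : τ (zR 1) = -zR 0) (h3 : τ (zR 2) = -zR 1)
    (h4 : τ (zR 3) = zR 3 + zR 1 * zR 2)
    : τ n6R = n6R := by
  simp only [n6R, map_mul, map_add, map_sub, map_pow, map_ofNat, h1, h2, h3, h4,
    tau_s τ h1 h2 h3]
  apply iot_injective
  simp only [σ₁R, map_add, map_sub, map_mul, map_neg, map_pow, map_ofNat, map_zero,
      iz0, iz1, iz2, iz3]
  ring

theorem tau_Theta (τ : Rring ≃ₐ[Z3loc] Rring)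
    (h1 : τ (zR 0) = -zR 2) (h2 : τ (zR 1) = -zR 0) (h3 : τ (zR 2) = -zR 1)
    (h4 : τ (zR 3) = zR 3 + zR 1 * zR 2)
    (v : V) : τ (Theta v) = Theta v := by
  simp only [Theta, map_add, map_mul, map_pow, tau_lam τ h1 h2 h3 h4, tau_n4 τ h1 h2 h3 h4,
    tau_n6 τ h1 h2 h3 h4, tau_s τ h1 h2 h3, tau_e τ h1 h2 h3]
  ring

theorem T_lam (τ : Rring ≃ₐ[Z3loc] Rring)
    (h1 : τ (zR 0) = -zR 2) (h2 : τ (zR 1) = -zR 0) (h3 : τ (zR 2) = -zR 1)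
    (h4 : τ (zR 3) = zR 3 + zR 1 * zR 2)
    (f : Atilde) {x : Rring} (h : InM (x + τ x)) :
    InM (lam f * x + τ (lam f * x)) := by
  rw [map_mul, tau_lam τ h1 h2 h3 h4, ← mul_add]
  exact M_lam f h

theorem T_add (τ : Rring ≃ₐ[Z3loc] Rring)
    (h1 : τ (zR 0) = -zR 2) (h2 : τ (zR 1) = -zR 0) (h3 : τ (zR 2) = -zR 1)
    (h4 : τ (zR 3) = zR 3 + zR 1 * zR 2)
    {x y : Rring} (h : InM (x + τ x)) (h' : InM (y + τ y)) :
    InM (x + y + τ (x + y)) := by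
  convert M_add h h' using 1
  rw [map_add]
  ring

theorem T_mon (τ : Rring ≃ₐ[Z3loc] Rring)
    (h1 : τ (zR 0) = -zR 2) (h2 : τ (zR 1) = -zR 0) (h3 : τ (zR 2) = -zR 1)
    (h4 : τ (zR 3) = zR 3 + zR 1 * zR 2)
    (i j : ℕ) : InM (σ₁R ^ i * σ₃R ^ j + τ (σ₁R ^ i * σ₃R ^ j)) := by
  have e : σ₁R ^ i * σ₃R ^ j + τ (σ₁R ^ i * σ₃R ^ j)
      = (1 + (-1) ^ (i + j)) * (σ₁R ^ i * σ₃R ^ j) := by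
    rw [map_mul, map_pow, map_pow, tau_s τ h1 h2 h3, tau_e τ h1 h2 h3, neg_pow σ₁R, neg_pow σ₃R]
    ring
  rw [e]
  rcases Nat.even_or_odd (i + j) with h | h
  · have hp : (-1 : Rring) ^ (i + j) = 1 := npow_even _ h
    rw [hp]
    convert M_lam 2 (M_even i j h) using 1
    rw [map_ofNat]
    ring
  · have hp : (-1 : Rring) ^ (i + j) = -1 := npow_odd _ h
    rw [hp]
    convert M_zero using 1
    ring

theorem T_monw (τ : Rring ≃ₐ[Z3loc] Rring)
    (h1 : τ (zR 0) = -zR 2) (h2 : τ (zR 1) = -zR 0) (h3 : τ (zR 2) = -zR 1)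
    (h4 : τ (zR 3) = zR 3 + zR 1 * zR 2)
    (i j : ℕ) : InM (σ₁R ^ i * σ₃R ^ j * wR + τ (σ₁R ^ i * σ₃R ^ j * wR)) := by
  have e : σ₁R ^ i * σ₃R ^ j * wR + τ (σ₁R ^ i * σ₃R ^ j * wR)
      = (1 - (-1) ^ (i + j)) * (σ₁R ^ i * σ₃R ^ j * wR) := by
    rw [map_mul, map_mul, map_pow, map_pow, tau_s τ h1 h2 h3, tau_e τ h1 h2 h3, tau_w τ h1 h2 h3,
      neg_pow σ₁R, neg_pow σ₃R]
    ring
  rw [e]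
  rcases Nat.even_or_odd (i + j) with h | h
  · have hp : (-1 : Rring) ^ (i + j) = 1 := npow_even _ h
    rw [hp]
    convert M_zero using 1
    ring
  · have hp : (-1 : Rring) ^ (i + j) = -1 := npow_odd _ h
    rw [hp]
    convert M_lam 2 (M_odd i j h) using 1
    rw [map_ofNat]
    ring

/-- good elements: those whose products with `ev c` have trace in the image -/
theorem T_ev (τ : Rring ≃ₐ[Z3loc] Rring)
    (h1 : τ (zR 0) = -zR 2) (h2 : τ (zR 1) = -zR 0) (h3 : τ (zR 2) = -zR 1)
    (h4 : τ (zR 3) = zR 3 + zR 1 * zR 2)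
    (t : Rring) (ht : ∀ i j : ℕ, InM (σ₁R ^ i * σ₃R ^ j * t + τ (σ₁R ^ i * σ₃R ^ j * t)))
    (c : MvPolynomial (Fin 3) Z3loc) : InM (ev c * t + τ (ev c * t)) := by
  induction c using MvPolynomial.induction_on' with
  | monomial u a =>
    have e : ev (monomial u a) * t = lam (C a * X 0 ^ (u 0)) * (σ₁R ^ (u 1) * σ₃R ^ (u 2) * t) := by
      rw [ev, aeval_monomial, Finsupp.prod_fintype _ _ (by simp), Fin.prod_univ_three]
      simp only [map_mul, map_pow, lamX0, Matrix.cons_val]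
      rw [show lam (C a) = algebraMap _ _ a from by simp [lam]]
      ring
    rw [e]
    exact T_lam τ h1 h2 h3 h4 _ (ht _ _)
  | add p q hp hq =>
    rw [map_add, add_mul]
    exact T_add τ h1 h2 h3 h4 hp hq

theorem tt_ev (τ : Rring ≃ₐ[Z3loc] Rring)
    (h1 : τ (zR 0) = -zR 2) (h2 : τ (zR 1) = -zR 0) (h3 : τ (zR 2) = -zR 1)
    (h : τ la2 = la2) (c : MvPolynomial (Fin 3) Z3loc) : τ (τ (ev c)) = ev c := by
  induction c using MvPolynomial.induction_on with
  | C a => simp [ev]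
  | add f g hf hg => simp only [map_add, hf, hg]
  | mul_X f i hf =>
    simp only [map_mul, hf]
    congr 1
    have hi : i = 0 ∨ i = 1 ∨ i = 2 := by omega
    rcases hi with rfl | rfl | rfl
    · rw [evX0, h, h]
    · rw [evX1, tau_s τ h1 h2 h3, map_neg, tau_s τ h1 h2 h3, neg_neg]
    · rw [evX2, tau_e τ h1 h2 h3, map_neg, tau_e τ h1 h2 h3, neg_neg]

theorem fixed_InM (τ : Rring ≃ₐ[Z3loc] Rring)
    (h1 : τ (zR 0) = -zR 2) (h2 : τ (zR 1) = -zR 0) (h3 : τ (zR 2) = -zR 1)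
    (h4 : τ (zR 3) = zR 3 + zR 1 * zR 2)
    (x : Rring) (hx : τ x = x) : InM x := by
  obtain ⟨n, hn, p0, p1, p2, q0, q1, q2, h⟩ := Gen_all x
  have hev := tt_ev τ h1 h2 h3 (tau_la2 τ h1 h2 h3 h4)
  have t0 : τ (τ (zR 0)) = zR 1 := by rw [h1, map_neg, h3, neg_neg]
  have t1 : τ (τ (zR 1)) = zR 2 := by rw [h2, map_neg, h1, neg_neg]
  have t2 : τ (τ (zR 2)) = zR 0 := by rw [h3, map_neg, h2, neg_neg]
  have k1 := congrArg (fun y => τ (τ y)) h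
  simp only [map_mul, map_add, map_pow, map_natCast, hx, hev, t0, t1] at k1
  have k2 := congrArg (fun y => τ (τ y)) k1
  simp only [map_mul, map_add, map_pow, map_natCast, hx, hev, t1, t2] at k2
  have k3 : ((6 * n : ℕ) : Rring) * x = ev (6 * p0) * 1 + ev (2 * p1) * σ₁R + ev (2 * p2) * σ₁R ^ 2
      + ev (2 * q0) * σ₁R + ev q2 * wR + ev (-3 * q2) * σ₃R := by
    simp only [map_mul, map_neg, map_ofNat]
    push_cast
    simp only [wR, σ₁R, σ₃R]
    linear_combination 2 * h + 2 * k1 + 2 * k2 +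
      (2 * ev q1 - 4 * ev p2) * hrel
      + ev q2 * (zR 0 + zR 1 + zR 2) * hrel
  have hs : ∀ k l : ℕ, ∀ i j : ℕ, InM (σ₁R ^ i * σ₃R ^ j * (σ₁R ^ k * σ₃R ^ l)
      + τ (σ₁R ^ i * σ₃R ^ j * (σ₁R ^ k * σ₃R ^ l))) := by
    intro k l i j
    have : σ₁R ^ i * σ₃R ^ j * (σ₁R ^ k * σ₃R ^ l) = σ₁R ^ (i + k) * σ₃R ^ (j + l) := by ring
    rw [this]
    exact T_mon τ h1 h2 h3 h4 _ _
  have k4 : InM (((6 * n : ℕ) : Rring) * x + τ (((6 * n : ℕ) : Rring) * x)) := by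
    rw [k3]
    refine T_add τ h1 h2 h3 h4 (T_add τ h1 h2 h3 h4 (T_add τ h1 h2 h3 h4 (T_add τ h1 h2 h3 h4
      (T_add τ h1 h2 h3 h4 ?_ ?_) ?_) ?_) ?_) ?_
    · exact T_ev τ h1 h2 h3 h4 _ (by simpa only [pow_zero, mul_one] using hs 0 0) _
    · exact T_ev τ h1 h2 h3 h4 _ (by simpa only [pow_zero, pow_one, mul_one] using hs 1 0) _
    · exact T_ev τ h1 h2 h3 h4 _ (by simpa only [pow_zero, pow_one, mul_one] using hs 2 0) _
    · exact T_ev τ h1 h2 h3 h4 _ (by simpa only [pow_zero, pow_one, mul_one] using hs 1 0) _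
    · exact T_ev τ h1 h2 h3 h4 _ (T_monw τ h1 h2 h3 h4) _
    · exact T_ev τ h1 h2 h3 h4 _ (by simpa only [pow_zero, pow_one, one_mul] using hs 0 1) _
  rw [map_mul, map_natCast, hx] at k4
  refine M_div (12 * n) (by omega) ?_
  convert k4 using 1
  push_cast
  ring

end tau

end Prf

/-- With `τ` the automorphism of `R` given by `z₁ ↦ −z₃, z₂ ↦ −z₁, z₃ ↦ −z₂, r ↦ r+z₂z₃`
and `S = {x ∈ R : τ(x) = x}`:  (i) `Θ` is injective with image exactly `S`; (ii) `Θ`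
intertwines the comultiplications: for the ring homomorphism `Φ : R → R[s]` fixing
`z₁, z₂, z₃` and sending `r ↦ r + s` one has `Φ(σ₁²) = σ₁²`, `Φ(σ₁⁴) = σ₁⁴`,
`Φ(σ₃²) = σ₃²`, `Φ(n₄) = n₄ + s·σ₁²`, `Φ(n₆) = n₆ + 2s·n₄ + s²·σ₁²`,
`Φ(σ₁²n₄) = σ₁²n₄ + s·σ₁⁴` and `Φ(σ₁²n₆) = σ₁²n₆ + 2s·σ₁²n₄ + s²·σ₁⁴`. -/
theorem Theta_injective_range_and_comodule
    (τ : Rring ≃ₐ[Z3loc] Rring)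
    (h1 : τ (zR 0) = -zR 2) (h2 : τ (zR 1) = -zR 0) (h3 : τ (zR 2) = -zR 1)
    (h4 : τ (zR 3) = zR 3 + zR 1 * zR 2)
    (Φ : Rring →ₐ[Z3loc] Polynomial Rring)
    (hz1 : Φ (zR 0) = Polynomial.C (zR 0)) (hz2 : Φ (zR 1) = Polynomial.C (zR 1))
    (hz3 : Φ (zR 2) = Polynomial.C (zR 2))
    (hr : Φ (zR 3) = Polynomial.C (zR 3) + Polynomial.X) :
    Function.Injective Theta ∧
    Set.range Theta = {x : Rring | τ x = x} ∧
    Φ (σ₁R ^ 2) = Polynomial.C (σ₁R ^ 2) ∧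
    Φ (σ₁R ^ 4) = Polynomial.C (σ₁R ^ 4) ∧
    Φ (σ₃R ^ 2) = Polynomial.C (σ₃R ^ 2) ∧
    Φ n4R = Polynomial.C n4R + Polynomial.C (σ₁R ^ 2) * Polynomial.X ∧
    Φ n6R = Polynomial.C n6R + 2 * Polynomial.C n4R * Polynomial.X
      + Polynomial.C (σ₁R ^ 2) * Polynomial.X ^ 2 ∧
    Φ (σ₁R ^ 2 * n4R) = Polynomial.C (σ₁R ^ 2 * n4R)
      + Polynomial.C (σ₁R ^ 4) * Polynomial.X ∧
    Φ (σ₁R ^ 2 * n6R) = Polynomial.C (σ₁R ^ 2 * n6R)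
      + 2 * Polynomial.C (σ₁R ^ 2 * n4R) * Polynomial.X
      + Polynomial.C (σ₁R ^ 4) * Polynomial.X ^ 2 := by
  have hs : Φ σ₁R = Polynomial.C σ₁R := by
    simp only [σ₁R, map_add, hz1, hz2, hz3]
  have he : Φ σ₃R = Polynomial.C σ₃R := by
    simp only [σ₃R, map_mul, hz1, hz2, hz3]
  have hn4 : Φ n4R = Polynomial.C n4R + Polynomial.C (σ₁R ^ 2) * Polynomial.X := by
    simp only [n4R, map_sub, map_mul, map_pow, hz1, hz2, hz3, hr, hs]
    ring
  have hn6 : Φ n6R = Polynomial.C n6R + 2 * Polynomial.C n4R * Polynomial.X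
      + Polynomial.C (σ₁R ^ 2) * Polynomial.X ^ 2 := by
    simp only [n6R, n4R, map_sub, map_add, map_mul, map_pow, map_ofNat, hz1, hz2, hz3, hr, hs]
    ring
  refine ⟨Prf.Theta_inj, ?_, ?_, ?_, ?_, hn4, hn6, ?_, ?_⟩
  · ext x
    constructor
    · rintro ⟨v, rfl⟩
      exact Prf.tau_Theta τ h1 h2 h3 h4 v
    · intro hx
      exact Prf.fixed_InM τ h1 h2 h3 h4 x hx
  · rw [map_pow, map_pow, hs]
  · rw [map_pow, map_pow, hs]
  · rw [map_pow, map_pow, he]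
  · rw [map_mul, hn4, map_pow, hs]
    simp only [map_mul, map_pow]
    ring
  · rw [map_mul, hn6, map_pow, hs]
    simp only [map_mul, map_pow]
    ring
end
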